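/- arXiv:1711.05493 — 3 statements merged into one kernel-verified Lean document; each statement's English description precedes it below -/
import Mathlib

section
/- Let A, B, C be n×n matrices that are banded with bandwidths k_A, k_B, k_C respectively (i.e., A[i,j] = 0 whenever |i − j| > k_A, and similarly for B and C), and suppose AX + XB = C. Then, for a conformal 2×2 block partition with square diagonal blocks, the matrix C₂₁ − A₂₁·X₁₁ − X₂₂·B₂₁ (the right-hand side of the Sylvester equation satisfied by the block X₂₁) has rank at most max{k_A + k_B, k_C}. -/
open Matrix

/-- Reindex a matrix indexed by `Fin p ⊕ Fin q` as an ordinary square matrix indexed by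
`Fin (p + q)`, with the first summand mapped to the indices `0, …, p-1` and the second to
`p, …, p+q-1`. -/
def toSq {α : Type*} {p q : ℕ} (M : Matrix (Fin p ⊕ Fin q) (Fin p ⊕ Fin q) α) :
    Matrix (Fin (p + q)) (Fin (p + q)) α :=
  M.submatrix finSumFinEquiv.symm finSumFinEquiv.symm

/-- `M` is banded with bandwidth `k`: `M[i,j] = 0` whenever `|i - j| > k`. -/
def BandedOf {α : Type*} [Zero α] {n : ℕ} (M : Matrix (Fin n) (Fin n) α) (k : ℕ) : Prop :=
  ∀ i j : Fin n, k < ((i : ℤ) - (j : ℤ)).natAbs → M i j = 0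

/-- Number of indices selected by an injection into `range r` bounds a diagonal indicator's rank. -/
lemma rank_indicator_le {n : ℕ} (P : Fin n → Prop) [DecidablePred P] (r : ℕ) (f : Fin n → ℕ)
    (hf : Function.Injective f) (h : ∀ i, P i → f i < r) :
    (Matrix.diagonal (fun i => if P i then (1 : ℝ) else 0)).rank ≤ r := by
  rw [Matrix.rank_diagonal]
  have key := Fintype.card_le_of_injective
    (fun i : {i : Fin n // (if P i then (1 : ℝ) else 0) ≠ 0} =>
      (⟨f i.1, h i.1 (by have := i.2; by_contra hc; simp [hc] at this)⟩ : Fin r))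
    (by
      intro a b hab
      simp only [Fin.mk.injEq] at hab
      exact Subtype.ext (hf hab))
  simpa using key

lemma rank_add_le_aux {p q : ℕ} (M N : Matrix (Fin q) (Fin p) ℝ) :
    (M + N).rank ≤ M.rank + N.rank := by
  unfold Matrix.rank
  rw [Matrix.mulVecLin_add]
  refine le_trans (Submodule.finrank_mono ?_) (Submodule.finrank_add_le_finrank_add_finrank _ _)
  exact LinearMap.range_add_le _ _

lemma rank_le_of_corner {p q : ℕ} (M : Matrix (Fin q) (Fin p) ℝ) (r c : ℕ)
    (h : ∀ (i : Fin q) (j : Fin p), r ≤ (i : ℕ) → (j : ℕ) + c < p → M i j = 0) :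
    M.rank ≤ r + c := by
  set D := Matrix.diagonal (fun i : Fin q => if (i : ℕ) < r then (1 : ℝ) else 0) with hD
  set E := Matrix.diagonal (fun j : Fin p => if p ≤ (j : ℕ) + c then (1 : ℝ) else 0) with hE
  have hM : M = D * M + (M - D * M) * E := by
    ext i j
    simp only [hD, hE, Matrix.add_apply, Matrix.diagonal_mul, Matrix.mul_diagonal,
      Matrix.sub_apply]
    by_cases h1 : (i : ℕ) < r
    · simp [h1]
    · by_cases h2 : p ≤ (j : ℕ) + c
      · simp [h1, h2]
      · simp [h1, h2, h i j (by omega) (by omega)]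
  have hDr : D.rank ≤ r :=
    rank_indicator_le _ r (fun i => (i : ℕ)) Fin.val_injective (fun _ hi => hi)
  have hEr : E.rank ≤ c :=
    rank_indicator_le _ c (fun j => p - 1 - (j : ℕ))
      (by
        intro a b hab
        have h1 := a.2
        have h2 := b.2
        apply Fin.ext
        simp only at hab
        omega)
      (by
        intro j hj
        have := j.2
        omega)
  rw [hM]
  exact (rank_add_le_aux _ _).trans (Nat.add_le_add
    ((Matrix.rank_mul_le_left _ _).trans hDr) ((Matrix.rank_mul_le_right _ _).trans hEr))

lemma banded_block21 {p q k : ℕ} {M11 : Matrix (Fin p) (Fin p) ℝ} {M12 : Matrix (Fin p) (Fin q) ℝ}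
    {M21 : Matrix (Fin q) (Fin p) ℝ} {M22 : Matrix (Fin q) (Fin q) ℝ}
    (h : BandedOf (toSq (fromBlocks M11 M12 M21 M22)) k) (i : Fin q) (j : Fin p)
    (hij : (j : ℕ) + k < p + i) : M21 i j = 0 := by
  have := h (Fin.natAdd p i) (Fin.castAdd q j) (by
    simp only [Fin.val_natAdd, Fin.val_castAdd]
    omega)
  simpa [toSq] using this

/-- **Rank bound for the right-hand side of the block Sylvester equation, banded case.**
If `A`, `B`, `C` are banded with bandwidths `k_A`, `k_B`, `k_C` and `AX + XB = C`, then in a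
conformal `2×2` block partition the matrix `C₂₁ - A₂₁ X₁₁ - X₂₂ B₂₁` has rank at most
`max (k_A + k_B) k_C`. -/
theorem sylvester_block21_rank_banded
    {p q kA kB kC : ℕ}
    (A11 B11 C11 X11 : Matrix (Fin p) (Fin p) ℝ)
    (A12 B12 C12 X12 : Matrix (Fin p) (Fin q) ℝ)
    (A21 B21 C21 X21 : Matrix (Fin q) (Fin p) ℝ)
    (A22 B22 C22 X22 : Matrix (Fin q) (Fin q) ℝ)
    (hAb : BandedOf (toSq (fromBlocks A11 A12 A21 A22)) kA)
    (hBb : BandedOf (toSq (fromBlocks B11 B12 B21 B22)) kB)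
    (hCb : BandedOf (toSq (fromBlocks C11 C12 C21 C22)) kC)
    (hX : fromBlocks A11 A12 A21 A22 * fromBlocks X11 X12 X21 X22 +
          fromBlocks X11 X12 X21 X22 * fromBlocks B11 B12 B21 B22 =
          fromBlocks C11 C12 C21 C22) :
    (C21 - A21 * X11 - X22 * B21).rank ≤ max (kA + kB) kC := by
  by_cases hk : kC ≤ kA + kB
  · refine (rank_le_of_corner _ kA kB ?_).trans (le_max_left _ _)
    intro i j hi hj
    have hA : ∀ l, A21 i l = 0 := fun l => banded_block21 hAb i l (by omega)
    have hB : ∀ l, B21 l j = 0 := fun l => banded_block21 hBb l j (by omega)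
    have hC : C21 i j = 0 := banded_block21 hCb i j (by omega)
    simp [Matrix.mul_apply, hA, hB, hC]
  · refine (rank_le_of_corner _ (kC - kB) kB ?_).trans
      ((show kC - kB + kB ≤ kC by omega).trans (le_max_right _ _))
    intro i j hi hj
    have hA : ∀ l, A21 i l = 0 := fun l => banded_block21 hAb i l (by omega)
    have hB : ∀ l, B21 l j = 0 := fun l => banded_block21 hBb l j (by omega)
    have hC : C21 i j = 0 := banded_block21 hCb i j (by omega)
    simp [Matrix.mul_apply, hA, hB, hC]
end

section
/- Let A be an n×n matrix with ε-quasiseparable rank at most k, and let Q be any (k+1)×(k+1) unitary matrix. Then the matrix (I_{n−k−1} ⊕ Q)·A, obtained by multiplying A on the left by the block-diagonal unitary matrix with identity block of size n−k−1 and block Q acting on the last k+1 rows, also has ε-quasiseparable rank at most k. -/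
open Matrix

/-- The spectral norm (operator 2-norm) of a matrix. -/
noncomputable def specNorm {𝕜 : Type*} [RCLike 𝕜] {m n : ℕ}
    (M : Matrix (Fin m) (Fin n) 𝕜) : ℝ :=
  ‖LinearMap.toContinuousLinearMap (Matrix.toEuclideanLin M)‖

/-- The lower off-diagonal block `A[p+1:n, 1:p]` (1-based indexing). -/
def lowerBlock {α : Type*} {n : ℕ} (A : Matrix (Fin n) (Fin n) α) (p : ℕ) (hp : p < n) :
    Matrix (Fin (n - p)) (Fin p) α :=
  A.submatrix (fun i => ⟨p + i.1, by have := i.2; omega⟩) (fun j => ⟨j.1, by have := j.2; omega⟩)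

/-- The upper off-diagonal block `A[1:p, p+1:n]` (1-based indexing). -/
def upperBlock {α : Type*} {n : ℕ} (A : Matrix (Fin n) (Fin n) α) (p : ℕ) (hp : p < n) :
    Matrix (Fin p) (Fin (n - p)) α :=
  A.submatrix (fun i => ⟨i.1, by have := i.2; omega⟩) (fun j => ⟨p + j.1, by have := j.2; omega⟩)

/-- `A` has `ε`-quasiseparable rank at most `k`: every off-diagonal block admits a rank-`≤ k`
approximation within `ε` in the spectral norm (equivalently, `σ_{k+1}` of every off-diagonal
block is at most `ε`). -/
def EpsQSRankLE {𝕜 : Type*} [RCLike 𝕜] {n : ℕ} (A : Matrix (Fin n) (Fin n) 𝕜)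
    (ε : ℝ) (k : ℕ) : Prop :=
  ∀ (p : ℕ), 1 ≤ p → ∀ hp : p < n,
    (∃ M, M.rank ≤ k ∧ specNorm (lowerBlock A p hp - M) ≤ ε) ∧
    (∃ M, M.rank ≤ k ∧ specNorm (upperBlock A p hp - M) ≤ ε)

open scoped Matrix.Norms.L2Operator in
theorem specNorm_eq_l2 {m n : ℕ} (M : Matrix (Fin m) (Fin n) ℂ) : specNorm M = ‖M‖ := rfl

open scoped Matrix.Norms.L2Operator in
theorem specNorm_isometry_mul_le {m n : ℕ} (B : Matrix (Fin m) (Fin m) ℂ)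
    (X : Matrix (Fin m) (Fin n) ℂ) (hB : Bᴴ * B = 1) : specNorm (B * X) ≤ specNorm X := by
  rw [specNorm_eq_l2, specNorm_eq_l2]
  have h : ‖B * X‖ * ‖B * X‖ = ‖X‖ * ‖X‖ := by
    rw [← Matrix.l2_opNorm_conjTranspose_mul_self, ← Matrix.l2_opNorm_conjTranspose_mul_self,
      Matrix.conjTranspose_mul, Matrix.mul_assoc, ← Matrix.mul_assoc Bᴴ, hB, Matrix.one_mul]
  nlinarith [norm_nonneg (B * X), norm_nonneg X]

theorem specNorm_zero' {m n : ℕ} : specNorm (0 : Matrix (Fin m) (Fin n) ℂ) = 0 := by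
  simp [specNorm]

theorem specNorm_nonneg' {m n : ℕ} (M : Matrix (Fin m) (Fin n) ℂ) : 0 ≤ specNorm M :=
  norm_nonneg _

theorem sum_tail {n : ℕ} (p : ℕ) (f : Fin n → ℂ) (hf : ∀ i : Fin n, i.1 < p → f i = 0) :
    ∑ i, f i = ∑ i : Fin (n - p), f ⟨p + i.1, by have := i.2; omega⟩ := by
  symm
  apply Fintype.sum_of_injective (fun i : Fin (n - p) => (⟨p + i.1, by have := i.2; omega⟩ : Fin n))
  · intro a b h
    simp only [Fin.mk.injEq] at h
    ext
    omega
  · intro i hi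
    apply hf
    by_contra hlt
    apply hi
    refine ⟨⟨i.1 - p, by have := i.2; omega⟩, ?_⟩
    ext
    simp only
    omega
  · intro i
    rfl

/-- The block-diagonal matrix agrees with the identity off the last block. -/
theorem toSq_eq_one {m k : ℕ} (Q : Matrix (Fin k) (Fin k) ℂ) (i j : Fin (m + k))
    (h : i.1 < m ∨ j.1 < m) :
    toSq (fromBlocks (1 : Matrix (Fin m) (Fin m) ℂ) 0 0 Q) i j =
      (1 : Matrix (Fin (m + k)) (Fin (m + k)) ℂ) i j := by
  unfold toSq
  induction i using Fin.addCases with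
  | left i =>
    induction j using Fin.addCases with
    | left j => simp [Matrix.one_apply]
    | right j => simp [Matrix.one_apply, Fin.ext_iff]; have := i.2; omega
  | right i =>
    induction j using Fin.addCases with
    | left j => simp [Matrix.one_apply, Fin.ext_iff]; have := j.2; omega
    | right j => simp at h

theorem toSq_isometry {m k : ℕ} (Q : Matrix (Fin k) (Fin k) ℂ)
    (hQ : Q ∈ Matrix.unitaryGroup (Fin k) ℂ) :
    (toSq (fromBlocks (1 : Matrix (Fin m) (Fin m) ℂ) 0 0 Q))ᴴ *
      toSq (fromBlocks (1 : Matrix (Fin m) (Fin m) ℂ) 0 0 Q) = 1 := by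
  have h : Qᴴ * Q = 1 := Matrix.mem_unitaryGroup_iff'.mp hQ
  unfold toSq
  rw [Matrix.conjTranspose_submatrix, Matrix.submatrix_mul_equiv, Matrix.fromBlocks_conjTranspose,
    Matrix.fromBlocks_multiply]
  simp [h]

/-- **`ε`-quasiseparability is preserved by unitary action on the last `k+1` rows.**
If `A` is an `n × n` matrix (`n = m + (k+1)`) of `ε`-quasiseparable rank at most `k` and `Q` is
any `(k+1) × (k+1)` unitary matrix, then `(I_{n-k-1} ⊕ Q)·A` also has `ε`-quasiseparable rank
at most `k`. -/
theorem epsQSRankLE_unitary_last_rows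
    {m k : ℕ} (A : Matrix (Fin (m + (k + 1))) (Fin (m + (k + 1))) ℂ) (ε : ℝ)
    (hA : EpsQSRankLE A ε k)
    (Q : Matrix (Fin (k + 1)) (Fin (k + 1)) ℂ) (hQ : Q ∈ Matrix.unitaryGroup (Fin (k + 1)) ℂ) :
    EpsQSRankLE (toSq (fromBlocks (1 : Matrix (Fin m) (Fin m) ℂ) 0 0 Q) * A) ε k := by
  intro p hp1 hp
  obtain ⟨⟨L, hLr, hL⟩, ⟨R, hRr, hR⟩⟩ := hA p hp1 hp
  have hε : 0 ≤ ε := (specNorm_nonneg' _).trans hL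
  by_cases hpm : p ≤ m
  · set U := toSq (fromBlocks (1 : Matrix (Fin m) (Fin m) ℂ) 0 0 Q) with hU
    have hUone : ∀ i j, i.1 < m ∨ j.1 < m → U i j = (1 : Matrix _ _ ℂ) i j :=
      fun i j h => toSq_eq_one Q i j h
    have hUU : Uᴴ * U = 1 := toSq_isometry Q hQ
    refine ⟨?_, R, hRr, ?_⟩
    · let g : Fin (m + (k + 1) - p) → Fin (m + (k + 1)) :=
        fun i => ⟨p + i.1, by have := i.2; omega⟩
      have hg : Function.Injective g := by
        intro a b h
        simp only [g, Fin.mk.injEq] at h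
        ext
        omega
      have hne : ∀ (i : Fin (m + (k + 1))) j, i.1 < p → i ≠ g j := by
        intro i j hi h
        have := congrArg Fin.val h
        simp only [g] at this
        omega
      let B := U.submatrix g g
      have hB : Bᴴ * B = 1 := by
        ext a b
        have h := congrFun (congrFun hUU (g a)) (g b)
        rw [Matrix.mul_apply, sum_tail p] at h
        · rw [Matrix.mul_apply]
          refine Eq.trans h ?_
          simp [Matrix.one_apply, hg.eq_iff]
        · intro i hi
          rw [hUone i (g b) (Or.inl (by omega)), Matrix.one_apply_ne (hne i b hi), mul_zero]
      have hlow : lowerBlock (U * A) p hp = B * lowerBlock A p hp := by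
        ext a b
        simp only [lowerBlock, Matrix.submatrix_apply]
        rw [Matrix.mul_apply, sum_tail p]
        · rw [Matrix.mul_apply]
          rfl
        · intro i hi
          change U (g a) i * _ = 0
          rw [hUone (g a) i (Or.inr (by omega)), Matrix.one_apply_ne (hne i a hi).symm, zero_mul]
      refine ⟨B * L, (Matrix.rank_mul_le_right B L).trans hLr, ?_⟩
      rw [hlow, ← Matrix.mul_sub]
      exact (specNorm_isometry_mul_le B _ hB).trans hL
    · have hup : upperBlock (U * A) p hp = upperBlock A p hp := by
        ext a b
        simp only [upperBlock, Matrix.submatrix_apply]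
        rw [Matrix.mul_apply]
        have : ∀ i, U ⟨a.1, by have := a.2; omega⟩ i =
            (1 : Matrix (Fin (m + (k + 1))) (Fin (m + (k + 1))) ℂ) ⟨a.1, by have := a.2; omega⟩ i :=
          fun i => hUone _ i (Or.inl (by have := a.2; change a.1 < m; omega))
        simp only [this]
        rw [← Matrix.mul_apply, Matrix.one_mul]
      rw [hup]
      exact hR
  · refine ⟨⟨_, ?_, by rw [sub_self, specNorm_zero']; exact hε⟩,
      ⟨_, ?_, by rw [sub_self, specNorm_zero']; exact hε⟩⟩
    · refine (Matrix.rank_le_height _).trans (by omega)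
    · refine (Matrix.rank_le_width _).trans (by omega)
end

section
/- Let A be a real symmetric positive definite n×n matrix of quasiseparable rank at most k_A with condition number κ_A, let M₁, …, M_s be n×n matrices with rank(M_j) ≤ r_j, and let C have quasiseparable rank at most k_C. Suppose X solves the generalized Lyapunov equation AX + XA + Σ_{j=1}^s M_j X M_jᵀ = C. Set k = 2k_A + k_C + Σ_{j=1}^s r_j and ρ = exp(π² / (2·log(4·κ_A))). Then for every off-diagonal block Y of X and every ℓ ≥ 1, there exists a matrix M of rank at most k·ℓ such that ‖Y − M‖₂ ≤ 4·ρ^(−2ℓ)·‖Y‖₂. -/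
open Matrix

/-- `A` has lower quasiseparable rank at most `k`: every submatrix contained entirely in the
strictly lower triangular part has rank at most `k`. -/
def LowerQSRankLE {𝕜 : Type*} [Field 𝕜] {n : ℕ} (A : Matrix (Fin n) (Fin n) 𝕜) (k : ℕ) : Prop :=
  ∀ (u v : ℕ) (r : Fin u → Fin n) (c : Fin v → Fin n),
    (∀ i j, (c j : ℕ) < (r i : ℕ)) → (A.submatrix r c).rank ≤ k

/-- `A` has upper quasiseparable rank at most `k`: every submatrix contained entirely in the
strictly upper triangular part has rank at most `k`. -/
def UpperQSRankLE {𝕜 : Type*} [Field 𝕜] {n : ℕ} (A : Matrix (Fin n) (Fin n) 𝕜) (k : ℕ) : Prop :=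
  ∀ (u v : ℕ) (r : Fin u → Fin n) (c : Fin v → Fin n),
    (∀ i j, (r i : ℕ) < (c j : ℕ)) → (A.submatrix r c).rank ≤ k

/-- `A` has quasiseparable rank at most `k`. -/
def QSRankLE {𝕜 : Type*} [Field 𝕜] {n : ℕ} (A : Matrix (Fin n) (Fin n) 𝕜) (k : ℕ) : Prop :=
  LowerQSRankLE A k ∧ UpperQSRankLE A k


section matpart
open scoped Matrix.Norms.L2Operator
set_option linter.unusedSectionVars false
variable {α β : Type*} [Fintype α] [DecidableEq α] [Fintype β] [DecidableEq β]

/-- Functional calculus of a real symmetric matrix. -/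
noncomputable def fcal {E : Matrix α α ℝ} (hE : E.IsHermitian) (f : ℝ → ℝ) : Matrix α α ℝ :=
  (hE.eigenvectorUnitary : Matrix α α ℝ) * diagonal (fun i => f (hE.eigenvalues i)) *
    star (hE.eigenvectorUnitary : Matrix α α ℝ)

lemma fcal_unit1 {E : Matrix α α ℝ} (hE : E.IsHermitian) :
    star (hE.eigenvectorUnitary : Matrix α α ℝ) * (hE.eigenvectorUnitary : Matrix α α ℝ) = 1 := by
  simp

lemma fcal_unit2 {E : Matrix α α ℝ} (hE : E.IsHermitian) :
    (hE.eigenvectorUnitary : Matrix α α ℝ) * star (hE.eigenvectorUnitary : Matrix α α ℝ) = 1 := by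
  simp

lemma fcal_id {E : Matrix α α ℝ} (hE : E.IsHermitian) : fcal hE (fun x => x) = E := by
  conv_rhs => rw [hE.spectral_theorem]
  rw [fcal, Unitary.conjStarAlgAut_apply]
  rfl

lemma fcal_const {E : Matrix α α ℝ} (hE : E.IsHermitian) (c : ℝ) :
    fcal hE (fun _ => c) = c • 1 := by
  rw [fcal, show (diagonal (fun _ : α => c)) = c • (1 : Matrix α α ℝ) by
    ext i j; simp [diagonal_apply, one_apply]]
  rw [mul_smul_comm, smul_mul_assoc, mul_one, fcal_unit2]

lemma fcal_mul {E : Matrix α α ℝ} (hE : E.IsHermitian) (f g : ℝ → ℝ) :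
    fcal hE f * fcal hE g = fcal hE (fun x => f x * g x) := by
  simp only [fcal]
  rw [show ∀ U D V D' : Matrix α α ℝ, U * D * V * (U * D' * V) = U * (D * (V * U) * D') * V by
    intros; simp only [mul_assoc]]
  rw [fcal_unit1, mul_one, diagonal_mul_diagonal]

lemma fcal_add {E : Matrix α α ℝ} (hE : E.IsHermitian) (f g : ℝ → ℝ) :
    fcal hE f + fcal hE g = fcal hE (fun x => f x + g x) := by
  simp only [fcal]
  rw [← add_mul, ← mul_add, diagonal_add]

lemma fcal_congr {E : Matrix α α ℝ} (hE : E.IsHermitian) {f g : ℝ → ℝ}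
    (h : ∀ i, f (hE.eigenvalues i) = g (hE.eigenvalues i)) : fcal hE f = fcal hE g := by
  simp only [fcal, h]

lemma fcal_norm_le {E : Matrix α α ℝ} (hE : E.IsHermitian) (f : ℝ → ℝ) {δ : ℝ} (hδ : 0 ≤ δ)
    (h : ∀ i, |f (hE.eigenvalues i)| ≤ δ) : ‖fcal hE f‖ ≤ δ := by
  rw [fcal]
  have h1 := CStarRing.norm_mul_coe_unitary
    ((hE.eigenvectorUnitary : Matrix α α ℝ) * diagonal (fun i => f (hE.eigenvalues i)))
    (star hE.eigenvectorUnitary)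
  have h2 := CStarRing.norm_coe_unitary_mul hE.eigenvectorUnitary
    (diagonal (fun i => f (hE.eigenvalues i)))
  rw [Unitary.coe_star] at h1
  rw [h1, h2, l2_opNorm_diagonal, pi_norm_le_iff_of_nonneg hδ]
  exact h

lemma eig_nonneg_of_fcal {E : Matrix α α ℝ} (hE : E.IsHermitian) (f : ℝ → ℝ)
    (h : (fcal hE f).PosSemidef) (i : α) : 0 ≤ f (hE.eigenvalues i) := by
  have h1 := h.conjTranspose_mul_mul_same (hE.eigenvectorUnitary : Matrix α α ℝ)
  have h2 : (hE.eigenvectorUnitary : Matrix α α ℝ)ᴴ * fcal hE f *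
      (hE.eigenvectorUnitary : Matrix α α ℝ) = diagonal (fun i => f (hE.eigenvalues i)) := by
    rw [← star_eq_conjTranspose, fcal]
    rw [show ∀ U D V : Matrix α α ℝ, V * (U * D * V) * U = (V * U) * D * (V * U) by
      intros; simp only [mul_assoc]]
    rw [fcal_unit1, mul_one, one_mul]
  rw [h2] at h1
  exact Matrix.posSemidef_diagonal_iff.1 h1 i

lemma fcal_psd {E : Matrix α α ℝ} (hE : E.IsHermitian) (f : ℝ → ℝ)
    (h : ∀ i, 0 ≤ f (hE.eigenvalues i)) : (fcal hE f).PosSemidef := by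
  rw [fcal, star_eq_conjTranspose]
  exact (Matrix.posSemidef_diagonal_iff.2 h).mul_mul_conjTranspose_same _

lemma fcal_sub_const {E : Matrix α α ℝ} (hE : E.IsHermitian) (a : ℝ) :
    fcal hE (fun x => x - a) = E - a • 1 := by
  have := fcal_add hE (fun x => x) (fun _ => -a)
  rw [fcal_id, fcal_const] at this
  simp only [sub_eq_add_neg]
  rw [← this, neg_smul]

lemma fcal_const_sub {E : Matrix α α ℝ} (hE : E.IsHermitian) (b : ℝ) :
    fcal hE (fun x => b - x) = b • 1 - E := by
  have h := fcal_add hE (fun x => b - x) (fun x => x)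
  simp only [sub_add_cancel] at h
  rw [fcal_id, fcal_const] at h
  rw [← h, add_sub_cancel_right]

lemma rank_add_le' (P Q : Matrix α β ℝ) : (P + Q).rank ≤ P.rank + Q.rank := by
  rw [Matrix.rank, Matrix.rank, Matrix.rank, Matrix.mulVecLin_add]
  calc _ ≤ Module.finrank ℝ ↥(LinearMap.range P.mulVecLin ⊔ LinearMap.range Q.mulVecLin) :=
        Submodule.finrank_mono (LinearMap.range_add_le _ _)
    _ ≤ _ := Submodule.finrank_add_le_finrank_add_finrank _ _

lemma rank_neg_le' (P : Matrix α β ℝ) : (-P).rank ≤ P.rank := by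
  have : -P = P * (-1 : Matrix β β ℝ) := by simp
  rw [this]; exact rank_mul_le_left _ _

lemma rank_sum_le' {ι : Type*} (s : Finset ι) (P : ι → Matrix α β ℝ) :
    (∑ i ∈ s, P i).rank ≤ ∑ i ∈ s, (P i).rank := by
  classical
  induction s using Finset.induction_on with
  | empty => simp
  | insert a s ha ih =>
    rw [Finset.sum_insert ha, Finset.sum_insert ha]
    exact (rank_add_le' _ _).trans (by omega)

lemma fadi_step {E : Matrix α α ℝ} {B : Matrix β β ℝ} (hE : E.IsHermitian) (hB : B.IsHermitian)
    (Y W : Matrix α β ℝ) (k : ℕ) (hW : W.rank ≤ k) (hEq : E * Y + Y * B = W)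
    (hEpos : ∀ i, 0 < hE.eigenvalues i) (hBpos : ∀ i, 0 < hB.eigenvalues i)
    (p : ℝ) (hp : 0 < p) :
    (Y - fcal hE (fun x => (x - p) / (x + p)) * Y * fcal hB (fun x => (x - p) / (x + p))).rank
      ≤ k := by
  set G := fcal hE (fun x => (x + p)⁻¹) with hG
  set H := fcal hB (fun x => (x + p)⁻¹) with hH
  have e1 : fcal hE (fun x => (x - p) / (x + p)) = G * (E - p • 1) := by
    rw [hG, ← fcal_sub_const hE, fcal_mul]
    refine fcal_congr hE fun i => ?_
    rw [div_eq_inv_mul]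
  have e2 : fcal hB (fun x => (x - p) / (x + p)) = (B - p • 1) * H := by
    rw [hH, ← fcal_sub_const hB, fcal_mul]
    refine fcal_congr hB fun i => ?_
    rw [div_eq_mul_inv]
  have e3 : G * (E - (-p) • 1) = 1 := by
    rw [hG, ← fcal_sub_const hE, fcal_mul, ← one_smul ℝ (1 : Matrix α α ℝ), ← fcal_const hE]
    refine fcal_congr hE fun i => ?_
    have := hEpos i
    rw [sub_neg_eq_add]
    exact inv_mul_cancel₀ (by positivity)
  have e4 : (B - (-p) • 1) * H = 1 := by
    rw [hH, ← fcal_sub_const hB, fcal_mul, ← one_smul ℝ (1 : Matrix β β ℝ), ← fcal_const hB]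
    refine fcal_congr hB fun i => ?_
    have := hBpos i
    rw [sub_neg_eq_add]
    exact mul_inv_cancel₀ (by positivity)
  have e5 : Y - fcal hE (fun x => (x - p) / (x + p)) * Y * fcal hB (fun x => (x - p) / (x + p))
      = G * W * ((2 * p) • H) := by
    have : Y = (G * (E - (-p) • 1)) * Y * ((B - (-p) • 1) * H) := by
      rw [e3, e4, Matrix.one_mul, Matrix.mul_one]
    refine (congrArg (fun Z => Z - fcal hE (fun x => (x - p) / (x + p)) * Y *
      fcal hB (fun x => (x - p) / (x + p))) this).trans ?_
    rw [e1, e2]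
    rw [← hEq]
    simp only [Matrix.mul_add, Matrix.add_mul, Matrix.mul_sub, Matrix.sub_mul, Matrix.mul_assoc,
      Matrix.smul_mul, Matrix.mul_smul, Matrix.one_mul, Matrix.mul_one, neg_smul, smul_sub,
      smul_add, smul_smul, Matrix.neg_mul, Matrix.mul_neg]
    module
  rw [e5]
  exact (rank_mul_le_left _ _).trans ((rank_mul_le_right _ _).trans hW)

lemma fadi {E : Matrix α α ℝ} {B : Matrix β β ℝ} (hE : E.IsHermitian) (hB : B.IsHermitian)
    (Y W : Matrix α β ℝ) (k : ℕ) (hW : W.rank ≤ k) (hEq : E * Y + Y * B = W)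
    (hEpos : ∀ i, 0 < hE.eigenvalues i) (hBpos : ∀ i, 0 < hB.eigenvalues i)
    (p : ℕ → ℝ) (hp : ∀ i, 0 < p i) (ℓ : ℕ) :
    (Y - fcal hE (fun x => ∏ i ∈ Finset.range ℓ, (x - p i) / (x + p i)) * Y *
      fcal hB (fun x => ∏ i ∈ Finset.range ℓ, (x - p i) / (x + p i))).rank ≤ k * ℓ := by
  induction ℓ with
  | zero => simp [fcal_const]
  | succ ℓ ih =>
    set RE := fcal hE (fun x => ∏ i ∈ Finset.range ℓ, (x - p i) / (x + p i)) with hRE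
    set RB := fcal hB (fun x => ∏ i ∈ Finset.range ℓ, (x - p i) / (x + p i)) with hRB
    have c1 : fcal hE (fun x => ∏ i ∈ Finset.range (ℓ + 1), (x - p i) / (x + p i)) =
        fcal hE (fun x => (x - p ℓ) / (x + p ℓ)) * RE := by
      rw [hRE, fcal_mul]; refine fcal_congr hE fun i => ?_
      rw [Finset.prod_range_succ, mul_comm]
    have c2 : fcal hB (fun x => ∏ i ∈ Finset.range (ℓ + 1), (x - p i) / (x + p i)) =
        RB * fcal hB (fun x => (x - p ℓ) / (x + p ℓ)) := by
      rw [hRB, fcal_mul]; refine fcal_congr hB fun i => ?_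
      rw [Finset.prod_range_succ]
    have c3 : E * RE = RE * E := by
      conv_lhs => rw [← fcal_id hE]
      conv_rhs => rw [← fcal_id hE]
      rw [hRE, fcal_id hE]
      nth_rewrite 1 [← fcal_id hE]
      nth_rewrite 4 [← fcal_id hE]
      rw [fcal_mul, fcal_mul]
      exact fcal_congr hE fun i => mul_comm _ _
    have c4 : RB * B = B * RB := by
      rw [hRB]
      nth_rewrite 2 [← fcal_id hB]
      nth_rewrite 3 [← fcal_id hB]
      rw [fcal_mul, fcal_mul]
      exact fcal_congr hB fun i => mul_comm _ _
    have st := fadi_step hE hB (RE * Y * RB) (RE * W * RB) k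
      ((rank_mul_le_left _ _).trans ((rank_mul_le_right _ _).trans hW))
      (by
        rw [← hEq]
        simp only [Matrix.mul_add, Matrix.add_mul]
        congr 1
        · rw [← Matrix.mul_assoc, ← Matrix.mul_assoc, c3]; simp only [Matrix.mul_assoc]
        · simp only [Matrix.mul_assoc]; rw [c4])
      hEpos hBpos (p ℓ) (hp ℓ)
    rw [c1, c2]
    have : Y - fcal hE (fun x => (x - p ℓ) / (x + p ℓ)) * RE * Y *
        (RB * fcal hB (fun x => (x - p ℓ) / (x + p ℓ))) = (Y - RE * Y * RB) +
        (RE * Y * RB - fcal hE (fun x => (x - p ℓ) / (x + p ℓ)) * (RE * Y * RB) *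
          fcal hB (fun x => (x - p ℓ) / (x + p ℓ))) := by
      simp only [Matrix.mul_assoc]; abel
    rw [this]
    refine (rank_add_le' _ _).trans ?_
    rw [mul_add, mul_one]
    omega

lemma sylv_core {E : Matrix α α ℝ} {B : Matrix β β ℝ} (hE : E.IsHermitian) (hB : B.IsHermitian)
    (Y W : Matrix α β ℝ) (k : ℕ) (hW : W.rank ≤ k) (hEq : E * Y + Y * B = W)
    (a b : ℝ) (ha : 0 < a) (hEa : (E - a • 1).PosSemidef) (hEb : (b • 1 - E).PosSemidef)
    (hBa : (B - a • 1).PosSemidef) (hBb : (b • 1 - B).PosSemidef)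
    (p : ℕ → ℝ) (hp : ∀ i, 0 < p i) (ℓ : ℕ) (δ : ℝ) (hδ0 : 0 ≤ δ)
    (hδ : ∀ x, a ≤ x → x ≤ b → |∏ i ∈ Finset.range ℓ, (x - p i) / (x + p i)| ≤ δ) :
    ∃ N : Matrix α β ℝ, N.rank ≤ k * ℓ ∧ ‖Y - N‖ ≤ δ ^ 2 * ‖Y‖ := by
  rw [← fcal_sub_const hE] at hEa
  rw [← fcal_sub_const hB] at hBa
  rw [← fcal_const_sub hE] at hEb
  rw [← fcal_const_sub hB] at hBb
  have e1 := eig_nonneg_of_fcal hE _ hEa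
  have e2 := eig_nonneg_of_fcal hE _ hEb
  have e3 := eig_nonneg_of_fcal hB _ hBa
  have e4 := eig_nonneg_of_fcal hB _ hBb
  refine ⟨_, fadi hE hB Y W k hW hEq (fun i => by linarith [e1 i]) (fun i => by linarith [e3 i])
    p hp ℓ, ?_⟩
  rw [sub_sub_cancel]
  have n1 := fcal_norm_le hE (fun x => ∏ i ∈ Finset.range ℓ, (x - p i) / (x + p i)) hδ0 (fun i => hδ _ (by linarith [e1 i]) (by linarith [e2 i]))
  have n2 := fcal_norm_le hB (fun x => ∏ i ∈ Finset.range ℓ, (x - p i) / (x + p i)) hδ0 (fun i => hδ _ (by linarith [e3 i]) (by linarith [e4 i]))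
  refine (l2_opNorm_mul _ _).trans ?_
  refine (mul_le_mul (l2_opNorm_mul _ _) n2 (norm_nonneg _) (by positivity)).trans ?_
  calc _ ≤ δ * ‖Y‖ * δ := by gcongr
    _ = _ := by ring

end matpart

section blocks
open scoped Matrix.Norms.L2Operator

lemma mul_block {α β ν : Type*} [Fintype α] [Fintype β] [Fintype ν]
    (e : α ⊕ β ≃ ν) {γ δ : Type*} (P Q : Matrix ν ν ℝ) (f : γ → ν) (g : δ → ν) :
    (P * Q).submatrix f g = P.submatrix f (e ∘ Sum.inl) * Q.submatrix (e ∘ Sum.inl) g +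
      P.submatrix f (e ∘ Sum.inr) * Q.submatrix (e ∘ Sum.inr) g := by
  ext i j
  simp only [submatrix_apply, mul_apply, Matrix.add_apply, Function.comp]
  rw [← e.sum_comp, Fintype.sum_sum_type]

lemma specNorm_eq {m n : ℕ} (P : Matrix (Fin m) (Fin n) ℝ) : specNorm P = ‖P‖ := rfl

lemma sub_block1 {γ ν : Type*} [DecidableEq γ] [DecidableEq ν] (A : Matrix ν ν ℝ) (c : ℝ)
    (f : γ → ν) (hf : Function.Injective f) :
    (A - c • 1).submatrix f f = A.submatrix f f - c • 1 := by
  ext i j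
  by_cases h : i = j
  · subst h; simp
  · have h' : f i ≠ f j := fun e => h (hf e)
    simp [one_apply, h, h']

lemma sub_block2 {γ ν : Type*} [DecidableEq γ] [DecidableEq ν] (A : Matrix ν ν ℝ) (c : ℝ)
    (f : γ → ν) (hf : Function.Injective f) :
    (c • 1 - A).submatrix f f = c • 1 - A.submatrix f f := by
  ext i j
  by_cases h : i = j
  · subst h; simp
  · have h' : f i ≠ f j := fun e => h (hf e)
    simp [one_apply, h, h']

lemma block_approx {α β ν : Type*} [Fintype α] [DecidableEq α] [Fintype β] [DecidableEq β]
    [Fintype ν] [DecidableEq ν] (e : α ⊕ β ≃ ν) {s kA kC : ℕ} (A C X : Matrix ν ν ℝ)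
    (M : Fin s → Matrix ν ν ℝ) (r : Fin s → ℕ) (hA : A.IsHermitian)
    (hAr : (A.submatrix (e ∘ Sum.inl) (e ∘ Sum.inr)).rank ≤ kA)
    (hCr : (C.submatrix (e ∘ Sum.inl) (e ∘ Sum.inr)).rank ≤ kC)
    (hM : ∀ j, (M j).rank ≤ r j)
    (hX : A * X + X * A + ∑ j, M j * X * (M j)ᵀ = C)
    (a b : ℝ) (ha : 0 < a) (hAa : (A - a • 1).PosSemidef) (hAb : (b • 1 - A).PosSemidef)
    (p : ℕ → ℝ) (hp : ∀ i, 0 < p i) (ℓ : ℕ) (δ : ℝ) (hδ0 : 0 ≤ δ)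
    (hδ : ∀ x, a ≤ x → x ≤ b → |∏ i ∈ Finset.range ℓ, (x - p i) / (x + p i)| ≤ δ) :
    ∃ N : Matrix α β ℝ, N.rank ≤ (2 * kA + kC + ∑ j, r j) * ℓ ∧
      ‖X.submatrix (e ∘ Sum.inl) (e ∘ Sum.inr) - N‖ ≤
        δ ^ 2 * ‖X.submatrix (e ∘ Sum.inl) (e ∘ Sum.inr)‖ := by
  have hil : Function.Injective (e ∘ Sum.inl) := e.injective.comp Sum.inl_injective
  have hir : Function.Injective (e ∘ Sum.inr) := e.injective.comp Sum.inr_injective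
  set Af := A.submatrix (e ∘ Sum.inl) (e ∘ Sum.inl)
  set Ag := A.submatrix (e ∘ Sum.inr) (e ∘ Sum.inr)
  set Afg := A.submatrix (e ∘ Sum.inl) (e ∘ Sum.inr)
  set Y := X.submatrix (e ∘ Sum.inl) (e ∘ Sum.inr)
  have hEq := congrArg (fun Z => Matrix.submatrix Z (e ∘ Sum.inl) (e ∘ Sum.inr)) hX
  simp only [submatrix_add, Pi.add_apply] at hEq
  rw [mul_block e A X, mul_block e X A] at hEq
  have hS : ((∑ j, M j * X * (M j)ᵀ).submatrix (e ∘ Sum.inl) (e ∘ Sum.inr)).rank ≤ ∑ j, r j := by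
    have : (∑ j, M j * X * (M j)ᵀ).submatrix (e ∘ Sum.inl) (e ∘ Sum.inr) =
        ∑ j, (M j * X * (M j)ᵀ).submatrix (e ∘ Sum.inl) (e ∘ Sum.inr) := by
      ext i j; simp [Matrix.sum_apply]
    rw [this]
    refine (rank_sum_le' _ _).trans (Finset.sum_le_sum fun j _ => ?_)
    rw [Matrix.mul_assoc, mul_block e]
    have h2 : (M j).submatrix (e ∘ Sum.inl) (e ∘ Sum.inl) *
        (X * (M j)ᵀ).submatrix (e ∘ Sum.inl) (e ∘ Sum.inr) +
        (M j).submatrix (e ∘ Sum.inl) (e ∘ Sum.inr) *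
        (X * (M j)ᵀ).submatrix (e ∘ Sum.inr) (e ∘ Sum.inr) =
        (M j).submatrix (e ∘ Sum.inl) id * (X * (M j)ᵀ).submatrix id (e ∘ Sum.inr) := by
      rw [← mul_block e, submatrix_mul _ _ _ id _ Function.bijective_id]
    rw [h2]
    refine (rank_mul_le_left _ _).trans (le_trans ?_ (hM j))
    have h3 : (M j).submatrix (e ∘ Sum.inl) id =
        (1 : Matrix ν ν ℝ).submatrix (e ∘ Sum.inl) id * M j := by
      ext i k; simp [mul_apply, one_apply]
    rw [h3]; exact rank_mul_le_right _ _
  refine sylv_core (hA.submatrix (e ∘ Sum.inl)) (hA.submatrix (e ∘ Sum.inr)) Y (Af * Y + Y * Ag) _ ?_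
    rfl a b ha ?_ ?_ ?_ ?_ p hp ℓ δ hδ0 hδ
  · have : Af * Y + Y * Ag = C.submatrix (e ∘ Sum.inl) (e ∘ Sum.inr) +
        (-((∑ j, M j * X * (M j)ᵀ).submatrix (e ∘ Sum.inl) (e ∘ Sum.inr)) +
        (-(Afg * X.submatrix (e ∘ Sum.inr) (e ∘ Sum.inr)) +
         -(X.submatrix (e ∘ Sum.inl) (e ∘ Sum.inl) * Afg))) := by
      rw [← hEq]; abel
    rw [this]
    have r1 := rank_neg_le' ((∑ j, M j * X * (M j)ᵀ).submatrix (e ∘ Sum.inl) (e ∘ Sum.inr))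
    have r2 := (rank_neg_le' (Afg * X.submatrix (e ∘ Sum.inr) (e ∘ Sum.inr))).trans
      (rank_mul_le_left _ _)
    have r3 := (rank_neg_le' (X.submatrix (e ∘ Sum.inl) (e ∘ Sum.inl) * Afg)).trans
      (rank_mul_le_right _ _)
    refine (rank_add_le' _ _).trans ?_
    have r4 := rank_add_le' (-((∑ j, M j * X * (M j)ᵀ).submatrix (e ∘ Sum.inl) (e ∘ Sum.inr)))
      (-(Afg * X.submatrix (e ∘ Sum.inr) (e ∘ Sum.inr)) +
         -(X.submatrix (e ∘ Sum.inl) (e ∘ Sum.inl) * Afg))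
    have r5 := rank_add_le' (-(Afg * X.submatrix (e ∘ Sum.inr) (e ∘ Sum.inr)))
         (-(X.submatrix (e ∘ Sum.inl) (e ∘ Sum.inl) * Afg))
    omega
  · rw [← sub_block1 A a _ hil]; exact hAa.submatrix _
  · rw [← sub_block2 A b _ hil]; exact hAb.submatrix _
  · rw [← sub_block1 A a _ hir]; exact hAa.submatrix _
  · rw [← sub_block2 A b _ hir]; exact hAb.submatrix _

lemma posdef_bounds {n : ℕ} (hn : 0 < n) (A : Matrix (Fin n) (Fin n) ℝ) (hA : A.PosDef) :
    0 < sInf (spectrum ℝ A) ∧ sInf (spectrum ℝ A) ≤ sSup (spectrum ℝ A) ∧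
    (A - sInf (spectrum ℝ A) • 1).PosSemidef ∧ (sSup (spectrum ℝ A) • 1 - A).PosSemidef := by
  have hH := hA.isHermitian
  have hfin : (spectrum ℝ A).Finite := Matrix.finite_real_spectrum
  have hmem := fun i => hH.eigenvalues_mem_spectrum_real i
  have hne : (spectrum ℝ A).Nonempty := ⟨_, hmem ⟨0, hn⟩⟩
  have h1 := hne.csInf_mem hfin
  refine ⟨?_, csInf_le_csSup hne hfin.bddBelow hfin.bddAbove, ?_, ?_⟩
  · rw [hH.spectrum_real_eq_range_eigenvalues] at h1 ⊢
    obtain ⟨i, hi⟩ := h1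
    rw [← hi]; exact hA.eigenvalues_pos i
  · rw [← fcal_sub_const hH]
    exact fcal_psd hH _ fun i => sub_nonneg.2 (csInf_le hfin.bddBelow (hmem i))
  · rw [← fcal_const_sub hH]
    exact fcal_psd hH _ fun i => sub_nonneg.2 (le_csSup hfin.bddAbove (hmem i))

/-- Splitting of `Fin n` at `p`, top indices first. -/
noncomputable def splitLower {n p : ℕ} (hp : p < n) : Fin (n - p) ⊕ Fin p ≃ Fin n :=
  Equiv.ofBijective (Sum.elim (fun i => ⟨p + i.1, by have := i.2; omega⟩)
    (fun j => ⟨j.1, by have := j.2; omega⟩)) (by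
    constructor
    · rintro (x | x) (y | y) h <;> simp [Fin.ext_iff] at h ⊢ <;> omega
    · intro x
      by_cases hx : x.1 < p
      · exact ⟨Sum.inr ⟨x.1, hx⟩, by simp⟩
      · refine ⟨Sum.inl ⟨x.1 - p, by omega⟩, ?_⟩
        simp only [Sum.elim_inl, Fin.ext_iff]
        omega)

end blocks

section theta
open Filter Topology

/-- The Gaussian weight of the theta series. -/
noncomputable def jc (T : ℝ) (n : ℤ) : ℝ := Real.exp (-T * ((n : ℝ) * (n + 1) / 2))

/-- The theta series. -/
noncomputable def thJ (T X : ℝ) : ℝ := ∑' n : ℤ, jc T n * X ^ n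

lemma jc_pos (T : ℝ) (n : ℤ) : 0 < jc T n := Real.exp_pos _

lemma jc_summable {T : ℝ} (hT : 0 < T) {X : ℝ} (hX : X ≠ 0) :
    Summable (fun n : ℤ => ‖jc T n * X ^ n‖) := by
  have hpi := Real.pi_pos
  have h := summable_pow_mul_jacobiTheta₂_term_bound ((T / 2 + |Real.log (|X|)|) / (2 * Real.pi))
    (T := T / (2 * Real.pi)) (by positivity) 0
  refine Summable.of_nonneg_of_le (fun n => norm_nonneg _) (fun n => ?_) h
  rw [norm_mul, norm_zpow, Real.norm_eq_abs, Real.norm_eq_abs, abs_of_pos (jc_pos T n),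
    pow_zero, one_mul, jc]
  have hXp : 0 < |X| := abs_pos.2 hX
  have hz : |X| ^ n = Real.exp ((n : ℝ) * Real.log (|X|)) := by
    rw [← Real.rpow_intCast, Real.rpow_def_of_pos hXp, mul_comm]
  rw [hz, ← Real.exp_add]
  apply Real.exp_le_exp.2
  have e : -Real.pi * (T / (2 * Real.pi) * (n : ℝ) ^ 2 -
      2 * ((T / 2 + |Real.log (|X|)|) / (2 * Real.pi)) * |(n : ℝ)|) =
      - T * n ^ 2 / 2 + (T / 2) * |(n : ℝ)| + |Real.log (|X|)| * |(n : ℝ)| := by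
    field_simp; ring
  push_cast
  rw [e]
  have h1 : (n : ℝ) * Real.log (|X|) ≤ |Real.log (|X|)| * |(n : ℝ)| := by
    rw [← abs_mul, mul_comm]; exact le_abs_self _
  have h2 : -(n : ℝ) ≤ |(n : ℝ)| := neg_le_abs _
  nlinarith

lemma jc_summable' {T : ℝ} (hT : 0 < T) {X : ℝ} (hX : X ≠ 0) :
    Summable (fun n : ℤ => jc T n * X ^ n) := (jc_summable hT hX).of_norm

/-- Finite q-factorial. -/
noncomputable def qf (q : ℝ) (N : ℕ) : ℝ := ∏ i ∈ Finset.range N, (1 - q ^ (i + 1))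

lemma qf_pos {q : ℝ} (hq0 : 0 < q) (hq1 : q < 1) (N : ℕ) : 0 < qf q N :=
  Finset.prod_pos fun i _ => sub_pos.2 (pow_lt_one₀ hq0.le hq1 (by omega))

lemma qf_succ (q : ℝ) (N : ℕ) : qf q (N + 1) = qf q N * (1 - q ^ (N + 1)) :=
  Finset.prod_range_succ _ _

lemma qf_le_one {q : ℝ} (hq0 : 0 < q) (hq1 : q < 1) (N : ℕ) : qf q N ≤ 1 :=
  Finset.prod_le_one (fun i _ => (sub_pos.2 (pow_lt_one₀ hq0.le hq1 (by omega))).le)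
    (fun i _ => by have : 0 < q ^ (i + 1) := by positivity
                   linarith)

lemma qf_lim {q : ℝ} (hq0 : 0 < q) (hq1 : q < 1) :
    ∃ L : ℝ, 0 < L ∧ Tendsto (qf q) atTop (𝓝 L) ∧ ∀ N, L ≤ qf q N := by
  have hs : Summable (fun i : ℕ => Real.log (1 + -q ^ (i + 1))) := by
    apply Real.summable_log_one_add_of_summable
    exact ((summable_nat_add_iff 1).2 (summable_geometric_of_lt_one hq0.le hq1)).neg
  have ht : Tendsto (qf q) atTop (𝓝 (Real.exp (∑' i : ℕ, Real.log (1 + -q ^ (i + 1))))) := by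
    have := (Real.continuous_exp.tendsto _).comp hs.hasSum.tendsto_sum_nat
    refine this.congr fun N => ?_
    simp only [Function.comp, Real.exp_sum, qf]
    refine Finset.prod_congr rfl fun i _ => ?_
    rw [Real.exp_log, sub_eq_add_neg]
    have := pow_lt_one₀ hq0.le hq1 (n := i + 1) (by omega)
    linarith
  refine ⟨_, Real.exp_pos _, ht, fun N => ?_⟩
  have ha : Antitone (qf q) := antitone_nat_of_succ_le fun n => by
    rw [qf_succ]
    have := qf_pos hq0 hq1 n
    have : 0 < q ^ (n + 1) := by positivity
    nlinarith
  exact ha.le_of_tendsto ht N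

lemma qbinom {q : ℝ} (hq0 : 0 < q) (hq1 : q < 1) (z : ℝ) (M : ℕ) :
    ∏ i ∈ Finset.range M, (1 + q ^ i * z) = ∑ j ∈ Finset.range (M + 1),
      qf q M / (qf q j * qf q (M - j)) * (q ^ (j.choose 2) * z ^ j) := by
  induction M with
  | zero => simp [qf]
  | succ M ih =>
    have hp := fun N => (qf_pos hq0 hq1 N).ne'
    have h0 : qf q 0 = 1 := by simp [qf]
    rw [Finset.prod_range_succ, ih, mul_add, mul_one]
    conv_lhs => 
      enter [1]
      rw [Finset.sum_range_succ']
    conv_lhs =>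
      enter [2]
      rw [Finset.sum_range_succ, add_mul, Finset.sum_mul]
    rw [Finset.sum_range_succ' _ (M + 1), Finset.sum_range_succ _ M]
    have key : ∀ j ∈ Finset.range M,
        qf q (M + 1) / (qf q (j + 1) * qf q (M + 1 - (j + 1))) *
          (q ^ ((j + 1).choose 2) * z ^ (j + 1)) =
        qf q M / (qf q (j + 1) * qf q (M - (j + 1))) * (q ^ ((j + 1).choose 2) * z ^ (j + 1)) +
        qf q M / (qf q j * qf q (M - j)) * (q ^ (j.choose 2) * z ^ j) * (q ^ M * z) := by
      intro j hj
      have hj := Finset.mem_range.1 hj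
      obtain ⟨d, rfl⟩ : ∃ d, M = j + 1 + d := ⟨M - (j + 1), by omega⟩
      have e1 : j + 1 + d + 1 - (j + 1) = d + 1 := by omega
      have e2 : j + 1 + d - (j + 1) = d := by omega
      have e3 : j + 1 + d - j = d + 1 := by omega
      have e4 : (j + 1).choose 2 = j + j.choose 2 := by
        rw [Nat.choose_succ_succ' j 1, Nat.choose_one_right]
      rw [e1, e2, e3, e4, qf_succ q (j + 1 + d), qf_succ q d, qf_succ q j]
      have a1 := hp j
      have a2 := hp d
      have a3 : 1 - q ^ (j + 1) ≠ 0 := (sub_pos.2 (pow_lt_one₀ hq0.le hq1 (by omega))).ne'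
      have a4 : 1 - q ^ (d + 1) ≠ 0 := (sub_pos.2 (pow_lt_one₀ hq0.le hq1 (by omega))).ne'
      field_simp
      ring
    rw [Finset.sum_congr rfl key, Finset.sum_add_distrib]
    have t1 : qf q (M + 1) / (qf q (M + 1) * qf q (M + 1 - (M + 1))) *
        (q ^ ((M + 1).choose 2) * z ^ (M + 1)) =
        qf q M / (qf q M * qf q (M - M)) * (q ^ (M.choose 2) * z ^ M) * (q ^ M * z) := by
      have e4 : (M + 1).choose 2 = M + M.choose 2 := by
        rw [Nat.choose_succ_succ' M 1, Nat.choose_one_right]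
      rw [Nat.sub_self, Nat.sub_self, h0, mul_one, mul_one, div_self (hp _), div_self (hp _), e4]
      ring
    rw [t1]
    simp only [Nat.sub_zero, h0, one_mul, div_self (hp _)]
    ring

/-- Finite theta product. -/
noncomputable def thF (q X : ℝ) (N : ℕ) : ℝ :=
  (∏ i ∈ Finset.range N, (1 + q ^ (i + 1) * X)) * ∏ i ∈ Finset.range N, (1 + q ^ i * X⁻¹)

lemma thF_eq {T : ℝ} (hT : 0 < T) {X : ℝ} (hX : X ≠ 0) (N : ℕ) :
    thF (Real.exp (-T)) X N = ∑ j ∈ Finset.range (2 * N + 1),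
      qf (Real.exp (-T)) (2 * N) / (qf (Real.exp (-T)) j * qf (Real.exp (-T)) (2 * N - j)) *
      (jc T ((j : ℤ) - N) * X ^ ((j : ℤ) - N)) := by
  set q := Real.exp (-T) with hq
  have hq0 : 0 < q := Real.exp_pos _
  have hq1 : q < 1 := by rw [hq]; exact Real.exp_lt_one_iff.2 (by linarith)
  have hb := qbinom hq0 hq1 (q * X / q ^ N) (2 * N)
  have hprod : ∏ i ∈ Finset.range (2 * N), (1 + q ^ i * (q * X / q ^ N)) =
      thF q X N * (X ^ N / q ^ (N.choose 2)) := by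
    rw [two_mul, Finset.prod_range_add]
    have h2 : ∏ i ∈ Finset.range N, (1 + q ^ (N + i) * (q * X / q ^ N)) =
        ∏ i ∈ Finset.range N, (1 + q ^ (i + 1) * X) := by
      refine Finset.prod_congr rfl fun i _ => ?_
      have : q ^ N ≠ 0 := by positivity
      field_simp
      ring
    have h1 : ∏ i ∈ Finset.range N, (1 + q ^ i * (q * X / q ^ N)) =
        (∏ i ∈ Finset.range N, (1 + q ^ i * X⁻¹)) * (X ^ N / q ^ (N.choose 2)) := by
      have h3 : X ^ N / q ^ (N.choose 2) = ∏ i ∈ Finset.range N, (X / q ^ i) := by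
        rw [Finset.prod_div_distrib, Finset.prod_const, Finset.card_range,
          Finset.prod_pow_eq_pow_sum, Finset.sum_range_id, Nat.choose_two_right]
      rw [h3, ← Finset.prod_mul_distrib, ← Finset.prod_range_reflect]
      refine Finset.prod_congr rfl fun i hi => ?_
      have hi := Finset.mem_range.1 hi
      obtain ⟨d, rfl⟩ : ∃ d, N = i + 1 + d := ⟨N - (i + 1), by omega⟩
      rw [show i + 1 + d - 1 - i = d by omega]
      field_simp
      ring
    rw [h1, h2, thF]; ring
  rw [hprod] at hb
  have hne : X ^ N / q ^ (N.choose 2) ≠ 0 := by positivity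
  have hb' := eq_div_of_mul_eq hne hb
  rw [hb', Finset.sum_div]
  refine Finset.sum_congr rfl fun j _ => ?_
  rw [mul_div_assoc]
  congr 1
  have hc : ∀ m : ℕ, q ^ m = Real.exp (-T * m) := fun m => by
    rw [hq, ← Real.exp_nat_mul]; ring_nf
  rw [zpow_sub₀ hX, zpow_natCast, zpow_natCast]
  have hz : (q * X / q ^ N) ^ j = Real.exp (-T * ((1 - N) * j)) * X ^ j := by
    have : q * X / q ^ N = Real.exp (-T * (1 - N)) * X := by
      rw [hc, hq, mul_sub, Real.exp_sub, mul_one]; ring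
    rw [this, mul_pow, ← Real.exp_nat_mul]; ring_nf
  rw [hz, hc, hc, jc]
  have he : Real.exp (-T * ((((j : ℤ) - N : ℤ) : ℝ) * ((((j : ℤ) - N : ℤ) : ℝ) + 1) / 2)) =
      Real.exp (-T * (j.choose 2 : ℕ)) * Real.exp (-T * ((1 - N) * j)) *
      Real.exp (-T * (N.choose 2 : ℕ)) := by
    rw [← Real.exp_add, ← Real.exp_add, Nat.cast_choose_two, Nat.cast_choose_two]
    push_cast
    ring_nf
  rw [he]
  have := (Real.exp_pos (-T * (N.choose 2 : ℕ))).ne'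
  field_simp

lemma thF_lim {T : ℝ} (hT : 0 < T) :
    ∃ L : ℝ, 0 < L ∧ ∀ X : ℝ, X ≠ 0 →
      Tendsto (thF (Real.exp (-T)) X) atTop (𝓝 (L * thJ T X)) := by
  set q := Real.exp (-T) with hq
  have hq0 : 0 < q := Real.exp_pos _
  have hq1 : q < 1 := by rw [hq]; exact Real.exp_lt_one_iff.2 (by linarith)
  obtain ⟨L, hL, hlim, hle⟩ := qf_lim hq0 hq1
  refine ⟨L / (L * L), by positivity, fun X hX => ?_⟩
  set c : ℕ → ℤ → ℝ := fun N n => if n ∈ Finset.Icc (-(N : ℤ)) N then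
    qf q (2 * N) / (qf q (n + N).toNat * qf q (2 * N - (n + N).toNat)) else 0 with hc
  have hF : ∀ N, thF q X N = ∑' n : ℤ, c N n * (jc T n * X ^ n) := by
    intro N
    rw [thF_eq hT hX, tsum_eq_sum (s := Finset.Icc (-(N : ℤ)) N)
      (fun n hn => by simp only [hc, if_neg hn, zero_mul])]
    refine Finset.sum_bij (fun j _ => (j : ℤ) - N) ?_ ?_ ?_ ?_
    · intro j hj; rw [Finset.mem_range] at hj; rw [Finset.mem_Icc]; omega
    · intro i _ j _ h; omega
    · intro n hn; rw [Finset.mem_Icc] at hn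
      exact ⟨(n + N).toNat, by rw [Finset.mem_range]; omega, by omega⟩
    · intro j hj
      rw [Finset.mem_range] at hj
      have : (j : ℤ) - N ∈ Finset.Icc (-(N : ℤ)) N := by rw [Finset.mem_Icc]; omega
      simp only [hc, if_pos this]
      rw [show ((j : ℤ) - N + N).toNat = j by omega]
  have hJ : L / (L * L) * thJ T X = ∑' n : ℤ, L / (L * L) * (jc T n * X ^ n) := by
    rw [tsum_mul_left]; rfl
  rw [hJ]
  refine (tendsto_tsum_of_dominated_convergence (f := fun N n => c N n * (jc T n * X ^ n))
    (bound := fun n => 1 / (L * L) * ‖jc T n * X ^ n‖)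
    ((jc_summable hT hX).mul_left _) ?_ ?_).congr (fun N => (hF N).symm)
  · intro n
    apply Tendsto.mul_const
    have hev : ∀ᶠ N : ℕ in atTop, qf q (2 * N) / (qf q (n + N).toNat *
        qf q (2 * N - (n + N).toNat)) = c N n := by
      filter_upwards [eventually_ge_atTop n.natAbs] with N hN
      have : n ∈ Finset.Icc (-(N : ℤ)) N := by rw [Finset.mem_Icc]; omega
      simp only [hc, if_pos this]
    refine Tendsto.congr' hev ?_
    have t1 : Tendsto (fun N : ℕ => 2 * N) atTop atTop :=
      tendsto_atTop_mono (fun N => by simp only [id]; omega) tendsto_id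
    have t2 : Tendsto (fun N : ℕ => (n + N).toNat) atTop atTop := by
      refine tendsto_atTop_atTop.2 fun b => ⟨b + n.natAbs, fun a ha => by omega⟩
    have t3 : Tendsto (fun N : ℕ => 2 * N - (n + N).toNat) atTop atTop := by
      refine tendsto_atTop_atTop.2 fun b => ⟨b + n.natAbs, fun a ha => by omega⟩
    exact (hlim.comp t1).div ((hlim.comp t2).mul (hlim.comp t3)) (by positivity)
  · refine Eventually.of_forall fun N n => ?_
    rw [norm_mul]
    refine mul_le_mul_of_nonneg_right ?_ (norm_nonneg _)
    simp only [hc]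
    split_ifs with h
    · have p1 := hle (n + N).toNat
      have p2 := hle (2 * N - (n + N).toNat)
      have p3 := qf_pos hq0 hq1 (2 * N)
      have p5 := qf_pos hq0 hq1 (n + N).toNat
      have p6 := qf_pos hq0 hq1 (2 * N - (n + N).toNat)
      have p4 := qf_le_one hq0 hq1 (2 * N)
      rw [Real.norm_eq_abs, abs_of_pos (by positivity)]
      gcongr
    · rw [norm_zero]; positivity

end theta
section theta2
open Filter Topology

lemma thJ_mul {S T : ℝ} (hS : 0 < S) (hT : 0 < T) {X Y : ℝ} (hX : X ≠ 0) (hY : Y ≠ 0) :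
    HasSum (fun z : ℤ × ℤ => jc S z.1 * X ^ z.1 * (jc T z.2 * Y ^ z.2)) (thJ S X * thJ T Y) := by
  have h := summable_mul_of_summable_norm (jc_summable hS hX) (jc_summable hT hY)
  have e := tsum_mul_tsum_of_summable_norm (jc_summable hS hX) (jc_summable hT hY)
  rw [thJ, thJ, e]
  exact h.hasSum

lemma jc_key (T : ℝ) (a b : ℤ) : jc T (a + b + 1) * jc T (a - b) =
      jc (2 * T) a * jc (2 * T) b * (Real.exp (-T) * Real.exp (-T) ^ a) := by
  have : Real.exp (-T) ^ a = Real.exp (-T * a) := by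
    rw [← Real.rpow_intCast, ← Real.exp_mul]
  rw [this]
  simp only [jc, ← Real.exp_add]
  push_cast
  ring_nf

lemma thJ_term {T : ℝ} {X Y : ℝ} (hX : X ≠ 0) (hY : Y ≠ 0) (a b : ℤ) :
    2 * (jc T (a + b + 1) * X ^ (a + b + 1) * (jc T (a - b) * Y ^ (a - b))) =
    2 * X * Real.exp (-T) * (jc (2 * T) a * (X * Y * Real.exp (-T)) ^ a *
      (jc (2 * T) b * (X / Y) ^ b)) := by
  have hj := jc_key T a b
  have e1 : X ^ (a + b + 1) = X ^ a * X ^ b * X := by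
    rw [zpow_add₀ hX, zpow_add₀ hX, zpow_one]
  rw [e1, zpow_sub₀ hY, mul_zpow, mul_zpow, div_zpow]
  generalize jc T (a + b + 1) = u at *
  generalize jc T (a - b) = v at *
  linear_combination (2 * X ^ a * X ^ b * X * (Y ^ a / Y ^ b)) * hj

lemma thJ_identity {T : ℝ} (hT : 0 < T) {X Y : ℝ} (hX : X ≠ 0) (hY : Y ≠ 0) :
    thJ T X * thJ T Y - thJ T (-X) * thJ T (-Y) =
      2 * X * Real.exp (-T) * (thJ (2 * T) (X * Y * Real.exp (-T)) * thJ (2 * T) (X / Y)) := by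
  have hq : Real.exp (-T) ≠ 0 := (Real.exp_pos _).ne'
  have hT2 : 0 < 2 * T := by linarith
  have h1 := thJ_mul hT hT hX hY
  have h2 := thJ_mul hT hT (neg_ne_zero.2 hX) (neg_ne_zero.2 hY)
  have h3 := thJ_mul hT2 hT2 (mul_ne_zero (mul_ne_zero hX hY) hq) (div_ne_zero hX hY)
  have h4 := h1.sub h2
  have h5 := h3.mul_left (2 * X * Real.exp (-T))
  have hsgn : ∀ z : ℤ × ℤ, jc T z.1 * X ^ z.1 * (jc T z.2 * Y ^ z.2) -
      jc T z.1 * (-X) ^ z.1 * (jc T z.2 * (-Y) ^ z.2) = (1 - (-1) ^ (z.1 + z.2)) *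
      (jc T z.1 * X ^ z.1 * (jc T z.2 * Y ^ z.2)) := by
    intro z
    rw [neg_eq_neg_one_mul X, neg_eq_neg_one_mul Y, mul_zpow, mul_zpow,
      zpow_add₀ (by norm_num : (-1 : ℝ) ≠ 0)]
    ring
  rw [funext hsgn] at h4
  have hφ : Function.Injective (fun z : ℤ × ℤ => ((z.1 + z.2 + 1, z.1 - z.2) : ℤ × ℤ)) := by
    rintro ⟨a, b⟩ ⟨c, d⟩ h
    simp only [Prod.mk.injEq] at h
    rw [Prod.mk.injEq]
    omega
  have h6 := (hφ.hasSum_iff (fun z hz => ?_)).2 h4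
  · have e : ((fun z : ℤ × ℤ => (1 - (-1) ^ (z.1 + z.2)) *
        (jc T z.1 * X ^ z.1 * (jc T z.2 * Y ^ z.2))) ∘
        (fun z : ℤ × ℤ => ((z.1 + z.2 + 1, z.1 - z.2) : ℤ × ℤ))) =
        fun z : ℤ × ℤ => 2 * X * Real.exp (-T) *
          (jc (2 * T) z.1 * (X * Y * Real.exp (-T)) ^ z.1 * (jc (2 * T) z.2 * (X / Y) ^ z.2)) := by
      funext z
      have ho : Odd (z.1 + z.2 + 1 + (z.1 - z.2)) := ⟨z.1, by ring⟩
      rw [← thJ_term hX hY z.1 z.2, Function.comp]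
      simp only [ho.neg_one_zpow]
      norm_num
    rw [e] at h6
    exact h6.unique h5
  · rcases Int.even_or_odd (z.1 + z.2) with he | ho
    · rw [he.neg_one_zpow]; ring
    · exfalso; apply hz
      obtain ⟨k, hk⟩ := ho
      refine ⟨(k, k - z.2), ?_⟩
      ext <;> simp only <;> omega

lemma thJ_pos {T : ℝ} (hT : 0 < T) {X : ℝ} (hX : 0 < X) : 0 < thJ T X :=
  (jc_summable' hT hX.ne').tsum_pos (fun n => (mul_pos (jc_pos T n) (zpow_pos hX n)).le) 0
    (mul_pos (jc_pos T 0) (zpow_pos hX 0))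

lemma thJ_abs_lt {T : ℝ} (hT : 0 < T) {X : ℝ} (hX : 0 < X) : |thJ T (-X)| < thJ T X := by
  have s1 := jc_summable' hT hX.ne'
  have s2 := jc_summable' hT (neg_ne_zero.2 hX.ne')
  have hp : ∀ n : ℤ, 0 < jc T n * X ^ n := fun n => mul_pos (jc_pos T n) (zpow_pos hX n)
  have hs : ∀ n : ℤ, jc T n * (-X) ^ n = (-1) ^ n * (jc T n * X ^ n) := fun n => by
    rw [neg_eq_neg_one_mul X, mul_zpow]; ring
  have hc : ∀ n : ℤ, (-1 : ℝ) ^ n = 1 ∨ (-1 : ℝ) ^ n = -1 := fun n => by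
    rcases Int.even_or_odd n with h | h
    · left; exact h.neg_one_zpow
    · right; exact h.neg_one_zpow
  rw [abs_lt]
  constructor
  · have := (s1.add s2).tsum_pos (fun n => by
      have := hp n
      rw [hs]; rcases hc n with h | h <;> rw [h] <;> linarith) 0 (by
      have := hp 0
      rw [hs, show ((-1 : ℝ) ^ (0 : ℤ)) = 1 from zpow_zero _]; linarith)
    rw [s1.tsum_add s2] at this
    unfold thJ; linarith
  · have := (s1.sub s2).tsum_pos (fun n => by
      have := hp n
      rw [hs]; rcases hc n with h | h <;> rw [h] <;> linarith) 1 (by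
      have := hp 1
      rw [hs, show ((-1 : ℝ) ^ (1 : ℤ)) = -1 from zpow_one _]; linarith)
    rw [s1.tsum_sub s2] at this
    unfold thJ; linarith

lemma exp_zpow' (t : ℝ) (n : ℤ) : Real.exp t ^ n = Real.exp (n * t) := by
  rw [← Real.rpow_intCast, ← Real.exp_mul, mul_comm]

lemma thJ_cont {T : ℝ} (hT : 0 < T) (ε : ℝ) (hε : |ε| = 1) (R : ℝ) :
    ContinuousOn (fun t : ℝ => thJ T (ε * Real.exp t)) (Set.Icc (-R) R) := by
  unfold thJ
  have hε0 : ε ≠ 0 := by rintro rfl; simp at hε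
  have b1 := jc_summable' hT (Real.exp_pos R).ne'
  have b2 := jc_summable' hT (Real.exp_pos (-R)).ne'
  refine continuousOn_tsum (u := fun n => jc T n * Real.exp R ^ n + jc T n * Real.exp (-R) ^ n)
    (fun n => ?_) (b1.add b2) ?_
  · refine continuousOn_const.mul (ContinuousOn.zpow₀ (by fun_prop) n fun t _ => Or.inl ?_)
    exact mul_ne_zero hε0 (Real.exp_pos t).ne'
  · intro n t ht
    rw [norm_mul, norm_zpow, Real.norm_eq_abs, Real.norm_eq_abs, abs_of_pos (jc_pos T n), abs_mul,
      hε, one_mul, abs_of_pos (Real.exp_pos t), ← mul_add]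
    refine mul_le_mul_of_nonneg_left ?_ (jc_pos T n).le
    rw [exp_zpow', exp_zpow', exp_zpow']
    have p1 := Real.exp_pos (n * R)
    have p2 := Real.exp_pos (n * -R)
    rcases le_total 0 (n : ℝ) with h | h
    · have : Real.exp (n * t) ≤ Real.exp (n * R) :=
        Real.exp_le_exp.2 (mul_le_mul_of_nonneg_left ht.2 h)
      linarith
    · have : Real.exp (n * t) ≤ Real.exp (n * -R) :=
        Real.exp_le_exp.2 (mul_le_mul_of_nonpos_left ht.1 h)
      linarith

lemma thJ_inv {T : ℝ} {X : ℝ} (hX : X ≠ 0) : thJ T X⁻¹ = X * thJ T X := by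
  unfold thJ
  rw [← tsum_mul_left]
  have e : ∀ n : ℤ, jc T n * X⁻¹ ^ n = X * (jc T (-1 - n) * X ^ (-1 - n)) := by
    intro n
    have : jc T (-1 - n) = jc T n := by simp only [jc]; push_cast; ring_nf
    rw [this, zpow_sub₀ hX, _root_.inv_zpow, _root_.zpow_neg_one]
    field_simp
  rw [tsum_congr e]
  exact (Equiv.subLeft (-1 : ℤ)).tsum_eq (fun n => X * (jc T n * X ^ n))

/-- Value of the theta series at the half period. -/
noncomputable def th3 (T : ℝ) : ℝ := ∑' n : ℤ, Real.exp (-(T / 2) * (n : ℝ) ^ 2)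
/-- Alternating version. -/
noncomputable def th4 (T : ℝ) : ℝ := ∑' n : ℤ, (-1) ^ n * Real.exp (-(T / 2) * (n : ℝ) ^ 2)

lemma th_term (T : ℝ) (n : ℤ) :
    jc T n * Real.exp (T / 2) ^ n = Real.exp (-(T / 2) * (n : ℝ) ^ 2) := by
  rw [exp_zpow', jc, ← Real.exp_add]; ring_nf

lemma th_term' (T : ℝ) (n : ℤ) :
    jc T n * (-Real.exp (T / 2)) ^ n = (-1) ^ n * Real.exp (-(T / 2) * (n : ℝ) ^ 2) := by
  rw [← th_term, neg_eq_neg_one_mul (Real.exp (T / 2)), mul_zpow]; ring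

lemma thJ_half (T : ℝ) : thJ T (Real.exp (T / 2)) = th3 T := tsum_congr (th_term T)
lemma thJ_half' (T : ℝ) : thJ T (-Real.exp (T / 2)) = th4 T := tsum_congr (th_term' T)

lemma th3_summable {T : ℝ} (hT : 0 < T) :
    Summable (fun n : ℤ => Real.exp (-(T / 2) * (n : ℝ) ^ 2)) :=
  (jc_summable' hT (Real.exp_pos (T / 2)).ne').congr (fun n => th_term T n)

lemma th4_summable {T : ℝ} (hT : 0 < T) :
    Summable (fun n : ℤ => (-1) ^ n * Real.exp (-(T / 2) * (n : ℝ) ^ 2)) :=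
  (jc_summable' hT (neg_ne_zero.2 (Real.exp_pos (T / 2)).ne')).congr (fun n => th_term' T n)

lemma th3_pos {T : ℝ} (hT : 0 < T) : 0 < th3 T := by
  rw [← thJ_half]; exact thJ_pos hT (Real.exp_pos _)

lemma sq_summable {c : ℝ} (hc : 0 < c) : Summable (fun n : ℤ => Real.exp (-c * (n : ℝ) ^ 2)) := by
  have := th3_summable (T := 2 * c) (by linarith)
  simpa using this

lemma kbound {c : ℝ} (hc : 0 < c) :
    Summable (fun n : ℤ => Real.exp (-c * ((n : ℝ) * (n + 1)))) ∧
    ∑' n : ℤ, Real.exp (-c * ((n : ℝ) * (n + 1))) ≤ 2 * ∑' n : ℤ, Real.exp (-c * (n : ℝ) ^ 2) := by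
  have s := sq_summable hc
  have s' : Summable (fun n : ℤ => Real.exp (-c * (((n + 1 : ℤ)) : ℝ) ^ 2)) :=
    (Equiv.addRight (1 : ℤ)).summable_iff.2 s
  have e' : ∑' n : ℤ, Real.exp (-c * (((n + 1 : ℤ)) : ℝ) ^ 2) = ∑' n : ℤ, Real.exp (-c * (n : ℝ) ^ 2) :=
    (Equiv.addRight (1 : ℤ)).tsum_eq (fun n : ℤ => Real.exp (-c * (n : ℝ) ^ 2))
  have hle : ∀ n : ℤ, Real.exp (-c * ((n : ℝ) * (n + 1))) ≤
      Real.exp (-c * (n : ℝ) ^ 2) + Real.exp (-c * (((n + 1 : ℤ)) : ℝ) ^ 2) := by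
    intro n
    have p1 := Real.exp_pos (-c * (n : ℝ) ^ 2)
    have p2 := Real.exp_pos (-c * (((n + 1 : ℤ)) : ℝ) ^ 2)
    rcases le_total 0 n with h | h
    · have h' : (0 : ℝ) ≤ n := by exact_mod_cast h
      have : Real.exp (-c * ((n : ℝ) * (n + 1))) ≤ Real.exp (-c * (n : ℝ) ^ 2) :=
        Real.exp_le_exp.2 (by nlinarith [mul_nonneg hc.le h'])
      linarith
    · rcases h.eq_or_lt with rfl | h
      · have : Real.exp (-c * (((0 : ℤ) : ℝ) * (((0 : ℤ) : ℝ) + 1))) ≤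
            Real.exp (-c * ((0 : ℤ) : ℝ) ^ 2) := Real.exp_le_exp.2 (by simp)
        linarith
      · have h' : (n : ℝ) + 1 ≤ 0 := by exact_mod_cast (by omega : n + 1 ≤ 0)
        have : Real.exp (-c * ((n : ℝ) * (n + 1))) ≤ Real.exp (-c * (((n + 1 : ℤ)) : ℝ) ^ 2) :=
          Real.exp_le_exp.2 (by push_cast; nlinarith [mul_nonneg hc.le (neg_nonneg.2 h')])
        linarith
  have sm := Summable.of_nonneg_of_le (fun n => (Real.exp_pos _).le) hle (s.add s')
  refine ⟨sm, (sm.tsum_le_tsum hle (s.add s')).trans ?_⟩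
  rw [s.tsum_add s', e', two_mul]

lemma th_lower {T : ℝ} (hT : 0 < T) :
    (1 - 2 * Real.exp (-(T / 2))) * th3 T ≤ (1 + 2 * Real.exp (-(T / 2))) * th4 T := by
  have s3 := th3_summable hT
  have s4 := th4_summable hT
  have hsub : th3 T - th4 T = 2 * Real.exp (-(T / 2)) *
      ∑' n : ℤ, Real.exp (-(2 * T) * ((n : ℝ) * (n + 1))) := by
    unfold th3 th4
    rw [← s3.tsum_sub s4, ← tsum_mul_left]
    have hi : Function.Injective (fun m : ℤ => 2 * m + 1) := fun a b h => by
      simp only at h; omega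
    rw [← hi.tsum_eq]
    · refine tsum_congr fun m => ?_
      have ho : Odd (2 * m + 1) := ⟨m, rfl⟩
      rw [ho.neg_one_zpow, mul_assoc, ← Real.exp_add]
      have : -(T / 2) * (((2 * m + 1 : ℤ)) : ℝ) ^ 2 = -(T / 2) + -(2 * T) * ((m : ℝ) * (m + 1)) := by
        push_cast; ring
      rw [this]; ring
    · intro n hn
      rcases Int.even_or_odd n with h | h
      · exfalso; apply hn; simp only [h.neg_one_zpow]; ring
      · obtain ⟨k, hk⟩ := h; exact ⟨k, hk.symm⟩
  have hadd : th3 T + th4 T = 2 * ∑' n : ℤ, Real.exp (-(2 * T) * (n : ℝ) ^ 2) := by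
    unfold th3 th4
    rw [← s3.tsum_add s4, ← tsum_mul_left]
    have hi : Function.Injective (fun m : ℤ => 2 * m) := fun a b h => by
      simp only at h; omega
    rw [← hi.tsum_eq]
    · refine tsum_congr fun m => ?_
      have ho : Even (2 * m) := ⟨m, by ring⟩
      rw [ho.neg_one_zpow]
      have : -(T / 2) * (((2 * m : ℤ)) : ℝ) ^ 2 = -(2 * T) * (m : ℝ) ^ 2 := by
        push_cast; ring
      rw [this]; ring
    · intro n hn
      rcases Int.even_or_odd n with h | h
      · obtain ⟨k, hk⟩ := h; exact ⟨k, by simp only; omega⟩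
      · exfalso; apply hn; simp only [h.neg_one_zpow]; ring
  have k := (kbound (c := 2 * T) (by linarith)).2
  have hw := Real.exp_pos (-(T / 2))
  nlinarith

lemma th_upper {T : ℝ} (hT : 0 < T) :
    0 ≤ th4 T ∧ th4 T ≤ 2 * Real.exp (-(Real.pi ^ 2 / (2 * T))) * th3 T := by
  have hpi := Real.pi_pos
  set c : ℝ := 2 * Real.pi ^ 2 / T with hc
  have hcp : 0 < c := by positivity
  have ha : 0 < (((T / (2 * Real.pi) : ℝ)) : ℂ).re := by
    rw [Complex.ofReal_re]; positivity
  have h3 := Complex.tsum_exp_neg_quadratic ha 0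
  have h4 := Complex.tsum_exp_neg_quadratic ha (-Complex.I / 2)
  set r : ℝ := 1 / (T / (2 * Real.pi)) ^ ((1 : ℝ) / 2) with hr
  have hrp : 0 < r := by positivity
  have hrc : 1 / (((T / (2 * Real.pi) : ℝ)) : ℂ) ^ ((1 : ℂ) / 2) = (r : ℂ) := by
    rw [hr]; push_cast
    rw [Complex.ofReal_cpow (by positivity)]
    push_cast; rfl
  have hpc : (Real.pi : ℂ) ≠ 0 := by exact_mod_cast hpi.ne'
  have hTc : (T : ℂ) ≠ 0 := by exact_mod_cast hT.ne'
  have e3 : th3 T = r * ∑' n : ℤ, Real.exp (-c * (n : ℝ) ^ 2) := by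
    rw [← Complex.ofReal_inj]
    push_cast [th3]
    rw [hrc] at h3
    convert h3 using 4 with n n
    · push_cast; field_simp; ring
    · rw [hc]; push_cast; field_simp; ring
  have e4 : th4 T = r * (Real.exp (-(Real.pi ^ 2 / (2 * T))) *
      ∑' n : ℤ, Real.exp (-c * ((n : ℝ) * (n + 1)))) := by
    rw [← Complex.ofReal_inj, ← tsum_mul_left]
    push_cast [th4]
    rw [hrc] at h4
    convert h4 using 4 with n n
    · have : (-1 : ℂ) ^ n = Complex.exp (-(Real.pi * Complex.I) * n) := by
        rw [mul_comm, Complex.exp_int_mul, Complex.exp_neg, Complex.exp_pi_mul_I]; norm_num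
      rw [this, ← Complex.exp_add]
      congr 1
      push_cast; field_simp; ring
    · rw [← Complex.exp_add]
      congr 1
      rw [hc]; push_cast; field_simp; ring_nf
      simp only [Complex.I_sq]; ring_nf
      simp
      ring
  rw [e3, e4]
  have k := (kbound hcp).2
  have he := Real.exp_pos (-(Real.pi ^ 2 / (2 * T)))
  have : r * (Real.exp (-(Real.pi ^ 2 / (2 * T))) *
      ∑' n : ℤ, Real.exp (-c * ((n : ℝ) * (n + 1)))) ≤ r * (Real.exp (-(Real.pi ^ 2 / (2 * T))) *
      (2 * ∑' n : ℤ, Real.exp (-c * (n : ℝ) ^ 2))) := by gcongr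
  refine ⟨mul_nonneg hrp.le (mul_nonneg he.le (tsum_nonneg fun n => (Real.exp_pos _).le)), ?_⟩
  linarith

end theta2
section theta3
open Filter Topology

/-- Elementary factor, equal to the absolute value of `tanh (u / 2)`. -/
noncomputable def DD (u : ℝ) : ℝ := |1 - Real.exp u| / (1 + Real.exp u)

lemma DD_nonneg (u : ℝ) : 0 ≤ DD u := by unfold DD; positivity

lemma DD_le_one (u : ℝ) : DD u ≤ 1 := by
  have := Real.exp_pos u
  unfold DD
  rw [div_le_one (by positivity), abs_le]
  constructor <;> linarith

lemma DD_neg (u : ℝ) : DD (-u) = DD u := by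
  have h := Real.exp_pos u
  unfold DD
  rw [Real.exp_neg]
  have e : 1 - (Real.exp u)⁻¹ = -(1 - Real.exp u) / Real.exp u := by field_simp; ring
  rw [e, abs_div, abs_neg, abs_of_pos h]
  field_simp
  ring

lemma DD_pair {τ A : ℝ} (h : |τ| ≤ A) : DD (τ + A) * DD (τ - A) ≤ DD A * DD A := by
  have h' := abs_le.1 h
  set E := Real.exp τ with hE
  set c := Real.exp A with hc
  have hEp : 0 < E := Real.exp_pos _
  have hcp : 0 < c := Real.exp_pos _
  have h1 : 1 ≤ E * c := by
    rw [hE, hc, ← Real.exp_add]; exact Real.one_le_exp (by linarith)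
  have h2 : E ≤ c := Real.exp_le_exp.2 h'.2
  have h3 : 1 ≤ c := Real.one_le_exp ((abs_nonneg τ).trans h)
  unfold DD
  rw [Real.exp_add, Real.exp_sub, ← hE, ← hc, abs_of_nonpos (by linarith : 1 - E * c ≤ 0),
    abs_of_nonneg (sub_nonneg.2 ((div_le_one hcp).2 h2)), abs_of_nonpos (by linarith : 1 - c ≤ 0)]
  have e : -(1 - E * c) / (1 + E * c) * ((1 - E / c) / (1 + E / c)) =
      ((E * c - 1) * (c - E)) / ((1 + E * c) * (c + E)) := by field_simp; ring
  rw [e, div_mul_div_comm, div_le_div_iff₀ (by positivity) (by positivity)]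
  have : 0 ≤ 2 * ((c ^ 2 + 1) * c) * (1 - E) ^ 2 := by positivity
  nlinarith

/-- Absolute value of the quotient of theta series. -/
noncomputable def SS (T u : ℝ) : ℝ := |thJ T (-Real.exp u)| / thJ T (Real.exp u)

lemma prod_Ico_sym (f : ℤ → ℝ) (N : ℕ) :
    ∏ n ∈ Finset.Ico (-(N : ℤ)) N, f n = ∏ i ∈ Finset.range N, (f i * f (-1 - i)) := by
  induction N with
  | zero => simp
  | succ N ih =>
    have e : Finset.Ico (-((N + 1 : ℕ) : ℤ)) ((N + 1 : ℕ) : ℤ) =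
        insert ((N : ℕ) : ℤ) (insert (-1 - (N : ℤ)) (Finset.Ico (-(N : ℤ)) N)) := by
      ext x; simp only [Finset.mem_insert, Finset.mem_Ico]; push_cast; omega
    rw [e, Finset.prod_insert, Finset.prod_insert, ih, Finset.prod_range_succ]
    · ring
    · simp only [Finset.mem_Ico]; omega
    · simp only [Finset.mem_insert, Finset.mem_Ico]; omega

lemma SS_lim {T : ℝ} (hT : 0 < T) (u : ℝ) :
    Tendsto (fun N : ℕ => ∏ n ∈ Finset.Ico (-(N : ℤ)) N, DD (u + n * T)) atTop (𝓝 (SS T u)) := by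
  obtain ⟨L, hL, hlim⟩ := thF_lim hT
  have hu := Real.exp_pos u
  have h1 := hlim _ hu.ne'
  have h2 := (hlim _ (neg_ne_zero.2 hu.ne')).abs
  have hp := thJ_pos hT hu
  have h3 := h2.div h1 (by positivity)
  have e : |L * thJ T (-Real.exp u)| / (L * thJ T (Real.exp u)) = SS T u := by
    rw [abs_mul, abs_of_pos hL, SS, mul_div_mul_left _ _ hL.ne']
  rw [e] at h3
  refine h3.congr fun N => ?_
  rw [prod_Ico_sym]
  simp only [Pi.div_apply, thF, abs_mul, Finset.abs_prod]
  rw [mul_div_mul_comm, ← Finset.prod_div_distrib, ← Finset.prod_div_distrib, mul_comm,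
    ← Finset.prod_mul_distrib]
  refine Finset.prod_congr rfl fun i _ => ?_
  congr 1
  · rw [← DD_neg, DD]
    have : Real.exp (-(u + ((i : ℤ) : ℝ) * T)) = Real.exp (-T) ^ i * (Real.exp u)⁻¹ := by
      rw [← Real.exp_nat_mul, ← Real.exp_neg, ← Real.exp_add]; push_cast; ring_nf
    rw [this, inv_neg, mul_neg, ← sub_eq_add_neg]
  · rw [DD]
    have : Real.exp (u + ((-1 - (i : ℤ) : ℤ) : ℝ) * T) = Real.exp (-T) ^ (i + 1) * Real.exp u := by
      rw [← Real.exp_nat_mul, ← Real.exp_add]; push_cast; ring_nf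
    rw [this, mul_neg, ← sub_eq_add_neg]

lemma SS_window (ℓ : ℕ) (hℓ : 1 ≤ ℓ) (F : ℤ → ℝ) (h0 : ∀ k, 0 ≤ F k) (h1 : ∀ k, F k ≤ 1)
    (j : ℤ) (hj0 : 0 ≤ j) (hj1 : j ≤ ℓ) (N : ℕ) (hN : 2 ≤ N) :
    ∏ i ∈ Finset.range ℓ, ((∏ n ∈ Finset.Ico (-(N : ℤ)) N, F (2 * ℓ * (n - 1) + (2 * ℓ - 1 - i))) *
      ∏ n ∈ Finset.Ico (-(N : ℤ)) N, F (2 * ℓ * (n - 1) + i)) ≤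
    ∏ m ∈ Finset.Ico (-(N : ℤ)) N, F (m - j) := by
  classical
  let S : Finset (ℕ × ℤ × Bool) := Finset.range ℓ ×ˢ (Finset.Ico (-(N : ℤ)) N ×ˢ Finset.univ)
  let g : ℕ × ℤ × Bool → ℤ := fun z =>
    if z.2.2 then 2 * ℓ * (z.2.1 - 1) + (2 * ℓ - 1 - z.1) else 2 * ℓ * (z.2.1 - 1) + z.1
  have hL : ∏ i ∈ Finset.range ℓ, ((∏ n ∈ Finset.Ico (-(N : ℤ)) N,
      F (2 * ℓ * (n - 1) + (2 * ℓ - 1 - i))) *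
      ∏ n ∈ Finset.Ico (-(N : ℤ)) N, F (2 * ℓ * (n - 1) + i)) = ∏ z ∈ S, F (g z) := by
    rw [Finset.prod_product]
    refine Finset.prod_congr rfl fun i _ => ?_
    rw [Finset.prod_product, ← Finset.prod_mul_distrib]
    refine Finset.prod_congr rfl fun n _ => ?_
    rw [Fintype.prod_bool]
    simp [g]
  have hdiv : ∀ (n : ℤ) (r : ℤ), 0 ≤ r → r < 2 * ℓ →
      (2 * ℓ * (n - 1) + r) / (2 * ℓ) = n - 1 ∧ (2 * ℓ * (n - 1) + r) % (2 * ℓ) = r := by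
    intro n r h0 h1
    have hp : (0 : ℤ) < 2 * ℓ := by omega
    constructor
    · rw [add_comm, Int.add_mul_ediv_left _ _ hp.ne', Int.ediv_eq_zero_of_lt h0 h1, zero_add]
    · rw [add_comm, Int.add_mul_emod_self_left, Int.emod_eq_of_lt h0 h1]
  have hg : Set.InjOn g S := by
    rintro ⟨i, n, b⟩ hz ⟨i', n', b'⟩ hz' h
    simp only [S, Finset.coe_product, Set.mem_prod, Finset.mem_coe, Finset.mem_range] at hz hz'
    have hi := hz.1
    have hi' := hz'.1
    have key : ∀ (i : ℕ) (n : ℤ) (b : Bool), i < ℓ → g (i, n, b) / (2 * ℓ) = n - 1 ∧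
        g (i, n, b) % (2 * ℓ) = if b then 2 * (ℓ : ℤ) - 1 - i else i := by
      intro i n b hi
      cases b
      · simpa [g] using hdiv n i (by omega) (by omega)
      · simpa [g] using hdiv n (2 * ℓ - 1 - i) (by omega) (by omega)
    have k1 := key i n b hi
    have k2 := key i' n' b' hi'
    rw [h] at k1
    have e1 := k1.1.symm.trans k2.1
    have e2 := k1.2.symm.trans k2.2
    have e3 : n = n' := by omega
    cases b <;> cases b' <;> simp at e2 <;> simp [e3] <;> omega
  rw [hL, ← Finset.prod_image (f := F) hg]
  have hW : ∏ m ∈ Finset.Ico (-(N : ℤ)) N, F (m - j) =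
      ∏ k ∈ (Finset.Ico (-(N : ℤ)) N).image (fun m => m - j), F k := by
    rw [Finset.prod_image]; intro a _ b _ h; simp only at h; omega
  rw [hW]
  have hsub : (Finset.Ico (-(N : ℤ)) N).image (fun m => m - j) ⊆ S.image g := ?_
  · rw [← Finset.prod_sdiff hsub]
    exact mul_le_of_le_one_left (Finset.prod_nonneg fun k _ => h0 k)
      (Finset.prod_le_one (fun k _ => h0 k) (fun k _ => h1 k))
  intro k hk
  obtain ⟨m, hm, rfl⟩ := Finset.mem_image.1 hk
  rw [Finset.mem_Ico] at hm
  rw [Finset.mem_image]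
  set k := m - j with hkd
  have hp : (0 : ℤ) < 2 * ℓ := by omega
  have d1 := Int.mul_ediv_add_emod k (2 * ℓ)
  have d2 := Int.emod_nonneg k hp.ne'
  have d3 := Int.emod_lt_of_pos k hp
  have hn : k / (2 * ℓ) + 1 ∈ Finset.Ico (-(N : ℤ)) N := by
    rw [Finset.mem_Ico]
    constructor
    · have : -(N : ℤ) - 1 ≤ k / (2 * ℓ) := by
        rw [Int.le_ediv_iff_mul_le hp]; nlinarith
      omega
    · have : k / (2 * ℓ) < N - 1 := by
        rw [Int.ediv_lt_iff_lt_mul hp]; nlinarith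
      omega
  by_cases hr : k % (2 * ℓ) < ℓ
  · refine ⟨((k % (2 * ℓ)).toNat, k / (2 * ℓ) + 1, false), ?_, ?_⟩
    · simp only [S, Finset.mem_product, Finset.mem_range, Finset.mem_univ, and_true]
      exact ⟨by omega, hn⟩
    · simp only [g, Bool.false_eq_true, if_false]
      rw [Int.toNat_of_nonneg d2, add_sub_cancel_right]
      exact d1
  · refine ⟨((2 * ℓ - 1 - k % (2 * ℓ)).toNat, k / (2 * ℓ) + 1, true), ?_, ?_⟩
    · simp only [S, Finset.mem_product, Finset.mem_range, Finset.mem_univ, and_true]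
      exact ⟨by omega, hn⟩
    · simp only [g, if_true]
      rw [Int.toNat_of_nonneg (by omega), add_sub_cancel_right]
      linarith

lemma SS_prod {T : ℝ} (hT : 0 < T) (ℓ : ℕ) (hℓ : 1 ≤ ℓ) (t : ℝ) (ht : -(T / 2) ≤ t)
    (ht' : t ≤ T / 2) :
    ∏ i ∈ Finset.range ℓ, (SS (2 * T) (t - ((i + 1 / 2) * (T / ℓ) - T / 2)) *
      SS (2 * T) (t + ((i + 1 / 2) * (T / ℓ) - T / 2) - T)) ≤
    2 * Real.exp (-(Real.pi ^ 2 * ℓ / (2 * T))) := by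
  have hℓ' : (0 : ℝ) < ℓ := by exact_mod_cast hℓ
  set h := T / ℓ with hh
  have hhp : 0 < h := by positivity
  have hTh : T = ℓ * h := by rw [hh]; field_simp
  set x := t / h + ℓ / 2 with hx
  have htx : t = h * (x - ℓ / 2) := by rw [hx]; field_simp; ring
  set j := round x with hj
  have hjx : |x - j| ≤ 1 / 2 := abs_sub_round x
  have hx0 : 0 ≤ x := by
    by_contra hc
    push Not at hc
    have : h * x < 0 := mul_neg_of_pos_of_neg hhp hc
    nlinarith
  have hx1 : x ≤ ℓ := by
    by_contra hc
    push Not at hc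
    have : h * ℓ < h * x := mul_lt_mul_of_pos_left hc hhp
    nlinarith
  have hjx' := abs_le.1 hjx
  have hj0 : 0 ≤ j := by
    have : (-1 : ℝ) < j := by linarith
    have : (-1 : ℤ) < j := by exact_mod_cast this
    omega
  have hj1 : j ≤ ℓ := by
    have : (j : ℝ) < ℓ + 1 := by linarith
    have : j < (ℓ : ℤ) + 1 := by exact_mod_cast this
    omega
  set τ := h * (x - j) with hτ
  have hτh : |τ| ≤ h / 2 := by
    rw [hτ, abs_mul, abs_of_pos hhp]; nlinarith
  have hlim : Tendsto (fun N : ℕ => ∏ i ∈ Finset.range ℓ,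
      ((∏ n ∈ Finset.Ico (-(N : ℤ)) N, DD (t - ((i + 1 / 2) * h - T / 2) + n * (2 * T))) *
      ∏ n ∈ Finset.Ico (-(N : ℤ)) N, DD (t + ((i + 1 / 2) * h - T / 2) - T + n * (2 * T))))
      atTop (𝓝 (∏ i ∈ Finset.range ℓ, (SS (2 * T) (t - ((i + 1 / 2) * h - T / 2)) *
      SS (2 * T) (t + ((i + 1 / 2) * h - T / 2) - T)))) :=
    tendsto_finsetProd _ fun i _ =>
      (SS_lim (by linarith) _).mul (SS_lim (by linarith) _)
  have hlim2 := SS_lim hhp (h / 2)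
  have hle : SS h (h / 2) ≤ 2 * Real.exp (-(Real.pi ^ 2 * ℓ / (2 * T))) := by
    obtain ⟨h4, hup⟩ := th_upper hhp
    have h3 := th3_pos hhp
    rw [SS, thJ_half, thJ_half', abs_of_nonneg h4, div_le_iff₀ h3]
    have : Real.pi ^ 2 * ℓ / (2 * T) = Real.pi ^ 2 / (2 * h) := by rw [hTh]; field_simp
    rw [this]; exact hup
  refine le_trans (le_of_tendsto_of_tendsto hlim hlim2 ?_) hle
  filter_upwards [eventually_ge_atTop 2] with N hN
  have hw := SS_window ℓ hℓ (fun k : ℤ => DD (t + h * (k + 1 / 2 + ℓ / 2)))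
    (fun k => DD_nonneg _) (fun k => DD_le_one _) j hj0 hj1 N hN
  have e1 : ∏ i ∈ Finset.range ℓ,
      ((∏ n ∈ Finset.Ico (-(N : ℤ)) N, DD (t - ((i + 1 / 2) * h - T / 2) + n * (2 * T))) *
      ∏ n ∈ Finset.Ico (-(N : ℤ)) N, DD (t + ((i + 1 / 2) * h - T / 2) - T + n * (2 * T))) =
      ∏ i ∈ Finset.range ℓ, ((∏ n ∈ Finset.Ico (-(N : ℤ)) N,
      (fun k : ℤ => DD (t + h * (k + 1 / 2 + ℓ / 2))) (2 * ℓ * (n - 1) + (2 * ℓ - 1 - i))) *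
      ∏ n ∈ Finset.Ico (-(N : ℤ)) N,
      (fun k : ℤ => DD (t + h * (k + 1 / 2 + ℓ / 2))) (2 * ℓ * (n - 1) + i)) := by
    refine Finset.prod_congr rfl fun i _ => ?_
    congr 1 <;> refine Finset.prod_congr rfl fun n _ => ?_
    · simp only; congr 1; push_cast; rw [hTh]; ring
    · simp only; congr 1; push_cast; rw [hTh]; ring
  rw [e1]
  refine hw.trans ?_
  rw [prod_Ico_sym, prod_Ico_sym]
  refine Finset.prod_le_prod (fun i _ => mul_nonneg (DD_nonneg _) (DD_nonneg _)) fun i _ => ?_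
  have hA : |τ| ≤ (i + 1 / 2) * h := by
    have : (0 : ℝ) ≤ i := Nat.cast_nonneg i
    nlinarith
  have hp := DD_pair hA
  have q1 : t + h * (((((i : ℕ) : ℤ) - j : ℤ) : ℝ) + 1 / 2 + ℓ / 2) = τ + (i + 1 / 2) * h := by
    rw [hτ]; push_cast; linear_combination htx
  have q2 : t + h * ((((-1 - ((i : ℕ) : ℤ)) - j : ℤ) : ℝ) + 1 / 2 + ℓ / 2) =
      τ - (i + 1 / 2) * h := by
    rw [hτ]; push_cast; linear_combination htx
  have q3 : h / 2 + (((i : ℕ) : ℤ) : ℝ) * h = (i + 1 / 2) * h := by push_cast; ring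
  have q4 : h / 2 + ((-1 - ((i : ℕ) : ℤ) : ℤ) : ℝ) * h = -((i + 1 / 2) * h) := by push_cast; ring
  simp only [q1, q2, q3, q4, DD_neg]
  exact hp

lemma zolo_bound (a b : ℝ) (ha : 0 < a) (hab : a ≤ b) (ℓ : ℕ) (hℓ : 1 ≤ ℓ) :
    ∃ p : ℕ → ℝ, (∀ i, 0 < p i) ∧ ∀ x, a ≤ x → x ≤ b →
      |∏ i ∈ Finset.range ℓ, (x - p i) / (x + p i)| ≤
        2 * Real.exp (-(Real.pi ^ 2 * ℓ / (2 * Real.log (4 * (b / a))))) := by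
  have hb : 0 < b := ha.trans_le hab
  have hκ : 1 ≤ b / a := (one_le_div ha).2 hab
  set T := Real.log (4 * (b / a)) with hTd
  have hT : 0 < T := Real.log_pos (by linarith)
  set r := Real.sqrt (b / a) with hr
  have hr1 : 1 ≤ r := Real.one_le_sqrt.2 hκ
  have hr2 : r * r = b / a := Real.mul_self_sqrt (by linarith)
  have hbr : b = a * r * r := by rw [mul_assoc, hr2]; field_simp
  set g := a * r with hg
  have hgp : 0 < g := by positivity
  have hw : Real.exp (-(T / 2)) = 1 / (2 * r) := by
    have h1 : Real.exp (T / 2) = 2 * r := by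
      have h2 : Real.exp (T / 2) * Real.exp (T / 2) = (2 * r) * (2 * r) := by
        rw [← Real.exp_add, add_halves, hTd, Real.exp_log (by linarith)]; nlinarith
      exact (mul_self_inj (Real.exp_pos _).le (by linarith)).1 h2
    rw [Real.exp_neg, h1, one_div]
  set s : ℝ → ℝ := fun t => thJ T (-Real.exp t) / thJ T (Real.exp t) with hs
  have hJ : ∀ t, 0 < thJ T (Real.exp t) := fun t => thJ_pos hT (Real.exp_pos t)
  have hsabs : ∀ t, |s t| < 1 := fun t => by
    simp only [hs]
    rw [abs_div, abs_of_pos (hJ t), div_lt_one (hJ t)]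
    exact thJ_abs_lt hT (Real.exp_pos t)
  have hsT : s (T / 2) = th4 T / th3 T := by simp only [hs, thJ_half, thJ_half']
  have hsneg : s (-(T / 2)) = -(th4 T / th3 T) := by
    have e1 : thJ T (Real.exp (-(T / 2))) = Real.exp (T / 2) * th3 T := by
      rw [Real.exp_neg, thJ_inv (Real.exp_pos _).ne', thJ_half]
    have e2 : thJ T (-Real.exp (-(T / 2))) = -Real.exp (T / 2) * th4 T := by
      rw [Real.exp_neg, ← inv_neg, thJ_inv (neg_ne_zero.2 (Real.exp_pos _).ne'), thJ_half']
    simp only [hs, e1, e2]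
    have := Real.exp_pos (T / 2)
    have := th3_pos hT
    field_simp
  have hcont : ContinuousOn s (Set.Icc (-(T / 2)) (T / 2)) := by
    have c1 := thJ_cont hT 1 (by simp) (T / 2)
    have c2 := thJ_cont hT (-1) (by simp) (T / 2)
    simp only [one_mul, neg_one_mul] at c1 c2
    exact c2.div c1 fun t _ => (hJ t).ne'
  have hσ0 : (r - 1) / (r + 1) ≤ th4 T / th3 T := by
    have hl := th_lower hT
    have h3 := th3_pos hT
    rw [hw] at hl
    rw [div_le_div_iff₀ (by linarith) h3]
    have hrp : 0 < r := by linarith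
    have e1 : 1 - 2 * (1 / (2 * r)) = (r - 1) / r := by field_simp
    have e2 : 1 + 2 * (1 / (2 * r)) = (r + 1) / r := by field_simp
    rw [e1, e2, div_mul_eq_mul_div, div_mul_eq_mul_div, div_le_div_iff_of_pos_right hrp] at hl
    linarith
  set tt : ℕ → ℝ := fun i => (i + 1 / 2) * (T / ℓ) - T / 2 with htt
  have hs1 : ∀ t, 0 < 1 - s t := fun t => by have := (abs_lt.1 (hsabs t)).2; linarith
  have hs2 : ∀ t, 0 < 1 + s t := fun t => by have := (abs_lt.1 (hsabs t)).1; linarith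
  refine ⟨fun i => g * ((1 + s (tt i)) / (1 - s (tt i))), fun i =>
    mul_pos hgp (div_pos (hs2 _) (hs1 _)), fun x hxa hxb => ?_⟩
  have hxp : 0 < x := ha.trans_le hxa
  have hσu : (x - g) / (x + g) ≤ (r - 1) / (r + 1) := by
    rw [div_le_div_iff₀ (by linarith) (by linarith)]
    have : x ≤ g * r := hxb.trans_eq hbr
    nlinarith
  have hσl : -((r - 1) / (r + 1)) ≤ (x - g) / (x + g) := by
    rw [← neg_div, div_le_div_iff₀ (by linarith) (by linarith)]
    have : g ≤ x * r := by rw [hg]; exact mul_le_mul_of_nonneg_right hxa (by linarith)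
    nlinarith
  have hmem : (x - g) / (x + g) ∈ Set.Icc (s (-(T / 2))) (s (T / 2)) := by
    rw [hsT, hsneg]; constructor <;> linarith
  obtain ⟨t, ht, hst⟩ := intermediate_value_Icc (by linarith : -(T / 2) ≤ T / 2) hcont hmem
  have hfac : ∀ i, |(x - g * ((1 + s (tt i)) / (1 - s (tt i)))) /
      (x + g * ((1 + s (tt i)) / (1 - s (tt i))))| =
      SS (2 * T) (t - tt i) * SS (2 * T) (t + tt i - T) := by
    intro i
    have hx : x = g * ((1 + s t) / (1 - s t)) := by
      have e1 : 1 + s t = 2 * x / (x + g) := by rw [hst]; field_simp; ring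
      have e2 : 1 - s t = 2 * g / (x + g) := by rw [hst]; field_simp; ring
      rw [e1, e2]
      field_simp
    have hX := Real.exp_pos t
    have hY := Real.exp_pos (tt i)
    have id1 := thJ_identity hT hX.ne' hY.ne'
    have id2 := thJ_identity hT (neg_ne_zero.2 hX.ne') hY.ne'
    have ex1 : Real.exp t * Real.exp (tt i) * Real.exp (-T) = Real.exp (t + tt i - T) := by
      rw [← Real.exp_add, ← Real.exp_add, sub_eq_add_neg]
    have ex2 : Real.exp t / Real.exp (tt i) = Real.exp (t - tt i) := (Real.exp_sub _ _).symm
    rw [ex1, ex2] at id1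
    rw [neg_neg, neg_mul, neg_mul, ex1, neg_div, ex2] at id2
    have hA := hJ t
    have hC := hJ (tt i)
    have hP := thJ_pos (T := 2 * T) (by linarith) (Real.exp_pos (t + tt i - T))
    have hQ := thJ_pos (T := 2 * T) (by linarith) (Real.exp_pos (t - tt i))
    have hden : 0 < 2 * Real.exp t * Real.exp (-T) *
      (thJ (2 * T) (Real.exp (t + tt i - T)) * thJ (2 * T) (Real.exp (t - tt i))) := by positivity
    have u1 := hs1 t
    have u2 := hs1 (tt i)
    have u3 := hs2 t
    have u4 := hs2 (tt i)
    have hstep : (x - g * ((1 + s (tt i)) / (1 - s (tt i)))) /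
        (x + g * ((1 + s (tt i)) / (1 - s (tt i)))) = (s t - s (tt i)) / (1 - s t * s (tt i)) := by
      have hd : 0 < 1 - s t * s (tt i) := by nlinarith
      have n1 : x - g * ((1 + s (tt i)) / (1 - s (tt i))) =
          2 * g / ((1 - s t) * (1 - s (tt i))) * (s t - s (tt i)) := by
        rw [hx]; field_simp; ring
      have n2 : x + g * ((1 + s (tt i)) / (1 - s (tt i))) =
          2 * g / ((1 - s t) * (1 - s (tt i))) * (1 - s t * s (tt i)) := by
        rw [hx]; field_simp; ring
      rw [n1, n2, mul_div_mul_left _ _ (by positivity)]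
    have hstep2 : (s t - s (tt i)) / (1 - s t * s (tt i)) =
        (thJ T (-Real.exp t) * thJ T (Real.exp (tt i)) -
          thJ T (Real.exp t) * thJ T (-Real.exp (tt i))) /
        (thJ T (Real.exp t) * thJ T (Real.exp (tt i)) -
          thJ T (-Real.exp t) * thJ T (-Real.exp (tt i))) := by
      have n1 : s t - s (tt i) = (thJ T (-Real.exp t) * thJ T (Real.exp (tt i)) -
          thJ T (Real.exp t) * thJ T (-Real.exp (tt i))) /
          (thJ T (Real.exp t) * thJ T (Real.exp (tt i))) := by
        simp only [hs]; field_simp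
      have n2 : 1 - s t * s (tt i) = (thJ T (Real.exp t) * thJ T (Real.exp (tt i)) -
          thJ T (-Real.exp t) * thJ T (-Real.exp (tt i))) /
          (thJ T (Real.exp t) * thJ T (Real.exp (tt i))) := by
        simp only [hs]; field_simp
      rw [n1, n2, div_div_div_cancel_right₀ (by positivity)]
    rw [hstep, hstep2, id1, id2, abs_div, abs_of_pos hden, SS, SS]
    simp only [abs_mul, abs_neg, abs_two, abs_of_pos hX, abs_of_pos (Real.exp_pos (-T))]
    field_simp
  rw [Finset.abs_prod, Finset.prod_congr rfl fun i _ => hfac i]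
  exact SS_prod hT ℓ hℓ t ht.1 ht.2

end theta3


/-- **Quasiseparable structure of solutions of generalized Lyapunov equations.**
If `A` is symmetric positive definite of quasiseparable rank at most `k_A` with condition
number `κ_A`, `rank (M_j) ≤ r_j`, `C` has quasiseparable rank at most `k_C`, and
`AX + XA + Σ_j M_j X M_jᵀ = C`, then with `k = 2k_A + k_C + Σ_j r_j` and
`ρ = exp(π² / (2 log(4 κ_A)))`, every off-diagonal block `Y` of `X` admits, for every `ℓ ≥ 1`,
a matrix of rank at most `k·ℓ` within `4 ρ^(-2ℓ) ‖Y‖₂` of `Y` in the spectral norm. -/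
theorem generalized_lyapunov_offdiag_low_rank_approx
    {n s kA kC : ℕ} (A C X : Matrix (Fin n) (Fin n) ℝ)
    (M : Fin s → Matrix (Fin n) (Fin n) ℝ) (r : Fin s → ℕ)
    (hA : A.PosDef) (hAqs : QSRankLE A kA)
    (κA : ℝ) (hκ : κA = sSup (spectrum ℝ A) / sInf (spectrum ℝ A))
    (hM : ∀ j, (M j).rank ≤ r j) (hCqs : QSRankLE C kC)
    (hX : A * X + X * A + ∑ j, M j * X * (M j)ᵀ = C)
    (k : ℕ) (hk : k = 2 * kA + kC + ∑ j, r j)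
    (ρ : ℝ) (hρ : ρ = Real.exp (Real.pi ^ 2 / (2 * Real.log (4 * κA)))) :
    ∀ (p : ℕ), 1 ≤ p → ∀ hp : p < n, ∀ ℓ : ℕ, 1 ≤ ℓ →
      (∃ N : Matrix (Fin (n - p)) (Fin p) ℝ, N.rank ≤ k * ℓ ∧
        specNorm (lowerBlock X p hp - N) ≤
          4 * ρ ^ (-(2 * (ℓ : ℤ))) * specNorm (lowerBlock X p hp)) ∧
      (∃ N : Matrix (Fin p) (Fin (n - p)) ℝ, N.rank ≤ k * ℓ ∧
        specNorm (upperBlock X p hp - N) ≤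
          4 * ρ ^ (-(2 * (ℓ : ℤ))) * specNorm (upperBlock X p hp)) := by
  intro p hp1 hp ℓ hℓ
  obtain ⟨ha, hab, hAa, hAb⟩ := posdef_bounds (by omega) A hA
  obtain ⟨q, hq, hδ⟩ := zolo_bound _ _ ha hab ℓ hℓ
  set a := sInf (spectrum ℝ A) with ha_def
  set b := sSup (spectrum ℝ A) with hb_def
  have hδ2 : (2 * Real.exp (-(Real.pi ^ 2 * ℓ / (2 * Real.log (4 * (b / a)))))) ^ 2 =
      4 * ρ ^ (-(2 * (ℓ : ℤ))) := by
    rw [hρ, hκ, ← Real.rpow_intCast, ← Real.exp_mul, mul_pow, ← Real.exp_nat_mul]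
    norm_num
    ring
  have low := block_approx (splitLower hp) A C X M r hA.isHermitian (kA := kA) (kC := kC)
    (hAqs.1 _ _ _ _ (fun i j => by show j.1 < p + i.1; omega))
    (hCqs.1 _ _ _ _ (fun i j => by show j.1 < p + i.1; omega)) hM hX a b ha hAa hAb q hq ℓ _
    (by positivity) hδ
  have upp := block_approx ((Equiv.sumComm _ _).trans (splitLower hp)) A C X M r
    hA.isHermitian (kA := kA) (kC := kC)
    (hAqs.2 _ _ _ _ (fun i j => by show i.1 < p + j.1; omega))
    (hCqs.2 _ _ _ _ (fun i j => by show i.1 < p + j.1; omega)) hM hX a b ha hAa hAb q hq ℓ _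
    (by positivity) hδ
  rw [hδ2, ← hk] at low upp
  exact ⟨low, upp⟩
end
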